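/- arXiv:1307.7414 — 4 statements merged into one kernel-verified Lean document; each statement's English description precedes it below -/
import Mathlib

section
/- Let R be a ring and let 𝓘 be an ideal of R-Mod that is closed under direct limits. If there is a set of morphisms 𝓘₀ ⊆ 𝓘 such that 𝓘 is the closure of 𝓘₀ under direct limits, then 𝓘 is a covering ideal, i.e., every left R-module admits an 𝓘-cover. -/
universe u

/-- An *ideal* `𝓘` of `R`-Mod: to each pair of left `R`-modules `(M, N)` it assigns an
additive subgroup `𝓘(M,N) ⊆ Hom_R(M,N)`, and `h ∘ f ∘ t ∈ 𝓘` whenever `f ∈ 𝓘` and `h`, `t`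
are arbitrary `R`-homomorphisms for which the composition is defined. -/
structure ModuleIdeal (R : Type u) [Ring R] : Type (u + 1) where
  mem : ∀ {M N : Type u} [AddCommGroup M] [AddCommGroup N] [Module R M] [Module R N],
    (M →ₗ[R] N) → Prop
  zero_mem : ∀ {M N : Type u} [AddCommGroup M] [AddCommGroup N] [Module R M] [Module R N],
    mem (0 : M →ₗ[R] N)
  add_mem : ∀ {M N : Type u} [AddCommGroup M] [AddCommGroup N] [Module R M] [Module R N]
    {f g : M →ₗ[R] N}, mem f → mem g → mem (f + g)
  neg_mem : ∀ {M N : Type u} [AddCommGroup M] [AddCommGroup N] [Module R M] [Module R N]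
    {f : M →ₗ[R] N}, mem f → mem (-f)
  comp_mem : ∀ {Q M N P : Type u} [AddCommGroup Q] [AddCommGroup M] [AddCommGroup N]
    [AddCommGroup P] [Module R Q] [Module R M] [Module R N] [Module R P]
    {f : M →ₗ[R] N} (h : N →ₗ[R] P) (t : Q →ₗ[R] M), mem f → mem (h.comp (f.comp t))

/-- An `𝓘`-precover of `M`: a morphism `i : F → M` in `𝓘` such that every morphism
`i' : F' → M` in `𝓘` factors through `i`. -/
def ModuleIdeal.IsPrecover {R : Type u} [Ring R] (I : ModuleIdeal R)
    {F M : Type u} [AddCommGroup F] [AddCommGroup M] [Module R F] [Module R M]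
    (i : F →ₗ[R] M) : Prop :=
  I.mem i ∧ ∀ (F' : Type u) [AddCommGroup F'] [Module R F'] (i' : F' →ₗ[R] M),
    I.mem i' → ∃ j : F' →ₗ[R] F, i.comp j = i'

/-- An `𝓘`-cover of `M`: an `𝓘`-precover `i` such that every `j : F → F` with `i ∘ j = i`
is an automorphism. -/
def ModuleIdeal.IsCover {R : Type u} [Ring R] (I : ModuleIdeal R)
    {F M : Type u} [AddCommGroup F] [AddCommGroup M] [Module R F] [Module R M]
    (i : F →ₗ[R] M) : Prop :=
  I.IsPrecover i ∧ ∀ j : F →ₗ[R] F, i.comp j = i → Function.Bijective j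

/-- An ideal `𝓘` is *closed under direct limits* if for every directed index set, every pair
of directed systems `(G i)`, `(H i)` and every compatible family of homomorphisms
`f i : G i → H i` in `𝓘`, the induced morphism `lim f : lim G → lim H` belongs to `𝓘`. -/
def ModuleIdeal.ClosedUnderDirectLimits {R : Type u} [Ring R] (I : ModuleIdeal R) : Prop :=
  ∀ (ι : Type u) [Preorder ι] [IsDirected ι (· ≤ ·)] [DecidableEq ι]
    (G H : ι → Type u) [∀ i, AddCommGroup (G i)] [∀ i, Module R (G i)]
    [∀ i, AddCommGroup (H i)] [∀ i, Module R (H i)]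
    (g : ∀ i j, i ≤ j → G i →ₗ[R] G j) (h : ∀ i j, i ≤ j → H i →ₗ[R] H j),
    DirectedSystem G (fun i j hij => g i j hij) →
    DirectedSystem H (fun i j hij => h i j hij) →
    ∀ f : ∀ i, G i →ₗ[R] H i,
      (∀ i j (hij : i ≤ j), (f j).comp (g i j hij) = (h i j hij).comp (f i)) →
      (∀ i, I.mem (f i)) →
      ∀ F : Module.DirectLimit G g →ₗ[R] Module.DirectLimit H h,
        (∀ i x, F (Module.DirectLimit.of R ι G g i x) =
          Module.DirectLimit.of R ι H h i (f i x)) →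
        I.mem F

/-- Data witnessing that the morphism `f` arises as the direct limit of a morphism
between directed systems of morphisms, each component of which is (isomorphic to) a member
of the set of morphisms `σ`. -/
structure DirectLimitPresentation (R : Type u) [Ring R] {M N : Type u}
    [AddCommGroup M] [AddCommGroup N] [Module R M] [Module R N] (f : M →ₗ[R] N)
    {S : Type u} (A B : S → Type u)
    [∀ s, AddCommGroup (A s)] [∀ s, Module R (A s)]
    [∀ s, AddCommGroup (B s)] [∀ s, Module R (B s)]
    (σ : ∀ s, A s →ₗ[R] B s) : Type (u + 1) where
  ι : Type u
  [pre : Preorder ι]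
  [dir : IsDirected ι (· ≤ ·)]
  [deq : DecidableEq ι]
  G : ι → Type u
  H : ι → Type u
  [instG₁ : ∀ i, AddCommGroup (G i)]
  [instG₂ : ∀ i, Module R (G i)]
  [instH₁ : ∀ i, AddCommGroup (H i)]
  [instH₂ : ∀ i, Module R (H i)]
  g : ∀ i j, i ≤ j → G i →ₗ[R] G j
  h : ∀ i j, i ≤ j → H i →ₗ[R] H j
  sysG : DirectedSystem G fun i j hij => g i j hij
  sysH : DirectedSystem H fun i j hij => h i j hij
  φ : ∀ i, G i →ₗ[R] H i
  compat : ∀ i j (hij : i ≤ j), (φ j).comp (g i j hij) = (h i j hij).comp (φ i)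
  mem₀ : ∀ i, ∃ (s : S) (e₁ : G i ≃ₗ[R] A s) (e₂ : H i ≃ₗ[R] B s),
    (σ s).comp (e₁ : G i →ₗ[R] A s) = (e₂ : H i →ₗ[R] B s).comp (φ i)
  eM : Module.DirectLimit G g ≃ₗ[R] M
  eN : Module.DirectLimit H h ≃ₗ[R] N
  limit_eq : ∀ i x, f (eM (Module.DirectLimit.of R ι G g i x)) =
    eN (Module.DirectLimit.of R ι H h i (φ i x))

namespace ModuleIdeal

variable {R : Type u} [Ring R] {I : ModuleIdeal R}

theorem mem_comp {M N P : Type u} [AddCommGroup M] [AddCommGroup N] [AddCommGroup P]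
    [Module R M] [Module R N] [Module R P] {f : M →ₗ[R] N} (hf : I.mem f) (t : P →ₗ[R] M) :
    I.mem (f.comp t) := by
  simpa using I.comp_mem LinearMap.id t hf

/-- A morphism out of a direct limit which lies in the ideal on every stage lies in the ideal. -/
theorem ClosedUnderDirectLimits.mem_of_directLimit (hI : I.ClosedUnderDirectLimits)
    {ι : Type u} [Preorder ι] [IsDirected ι (· ≤ ·)] {G : ι → Type u}
    [∀ i, AddCommGroup (G i)] [∀ i, Module R (G i)] (g : ∀ i j, i ≤ j → G i →ₗ[R] G j)
    (sys : DirectedSystem G fun i j hij => g i j hij)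
    {N M : Type u} [AddCommGroup N] [Module R N] [AddCommGroup M] [Module R M]
    (p : ∀ i, G i →ₗ[R] N) (hp : ∀ i j hij x, p j (g i j hij x) = p i x)
    (hsurj : ∀ n, ∃ i x, p i x = n)
    (hker : ∀ i x, p i x = 0 → ∃ j, ∃ hij : i ≤ j, g i j hij x = 0)
    {f : N →ₗ[R] M} (hf : ∀ i, I.mem (f.comp (p i))) : I.mem f := by
  classical
  have : Nonempty ι := (hsurj 0).nonempty
  let e := Module.DirectLimit.lift R ι G g p hp
  have he : Function.Bijective e := by
    refine ⟨(injective_iff_map_eq_zero e).2 fun z hz => ?_, fun n => ?_⟩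
    · obtain ⟨i, x, rfl⟩ := Module.DirectLimit.exists_of z
      obtain ⟨j, hij, h0⟩ := hker i x (by simpa [e] using hz)
      rw [← Module.DirectLimit.of_f (hij := hij), h0, map_zero]
    · obtain ⟨i, x, rfl⟩ := hsurj n
      exact ⟨Module.DirectLimit.of R ι G g i x, by simp [e]⟩
  let E := LinearEquiv.ofBijective e he
  let c : ∀ i j : ι, i ≤ j → M →ₗ[R] M := fun _ _ _ => LinearMap.id
  let F : Module.DirectLimit G g →ₗ[R] Module.DirectLimit (fun _ : ι => M) c :=
    Module.DirectLimit.lift R ι G g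
      (fun i => (Module.DirectLimit.of R ι (fun _ => M) c i).comp (f.comp (p i)))
      (fun i j hij x => by
        simp only [LinearMap.comp_apply, hp]
        exact Module.DirectLimit.of_f (f := c) (hij := hij))
  let b : Module.DirectLimit (fun _ : ι => M) c →ₗ[R] M :=
    Module.DirectLimit.lift R ι (fun _ => M) c (fun _ => LinearMap.id) (fun _ _ _ _ => rfl)
  have hF : I.mem F := by
    refine hI ι G (fun _ => M) g c sys ⟨fun _ _ => rfl, fun _ _ _ _ _ _ => rfl⟩
      (fun i => f.comp (p i)) (fun i j hij => ?_) hf F fun i x => by simp [F]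
    ext x
    simp [c, hp]
  have hfac : f = b.comp (F.comp (E.symm : N →ₗ[R] Module.DirectLimit G g)) := by
    ext n
    obtain ⟨z, rfl⟩ := E.surjective n
    obtain ⟨i, x, rfl⟩ := Module.DirectLimit.exists_of z
    simp only [LinearMap.comp_apply, LinearEquiv.coe_coe, LinearEquiv.symm_apply_apply]
    simp [F, b, E, e]
  rw [hfac]
  exact I.comp_mem b _ hF

/-- If `N` is the direct limit of quotients `P ⧸ Y i` of a module `P`, then `f : N → M` lies in
the ideal as soon as each `P ⧸ Y i → M` factors through a member of the ideal. -/
theorem ClosedUnderDirectLimits.mem_of_quotients (hI : I.ClosedUnderDirectLimits)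
    {ι : Type u} [Preorder ι] [IsDirected ι (· ≤ ·)]
    {P N M : Type u} [AddCommGroup P] [Module R P] [AddCommGroup N] [Module R N]
    [AddCommGroup M] [Module R M] (p : P →ₗ[R] N) (hp : Function.Surjective p)
    (Y : ι → Submodule R P) (hmono : Monotone Y) (hY : ∀ x, p x = 0 ↔ ∃ i, x ∈ Y i)
    {f : N →ₗ[R] M}
    (hf : ∀ i, ∃ (Q : Type u) (_ : AddCommGroup Q) (_ : Module R Q) (q : P →ₗ[R] Q)
      (h : Q →ₗ[R] M), I.mem h ∧ h.comp q = f.comp p ∧ Y i ≤ LinearMap.ker q) : I.mem f := by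
  obtain ⟨i₀, -⟩ := (hY 0).1 (map_zero p)
  have hle : ∀ i, Y i ≤ LinearMap.ker p := fun i x hx => (hY x).2 ⟨i, hx⟩
  refine hI.mem_of_directLimit (G := fun i => P ⧸ Y i)
    (fun i j hij => Submodule.factor (hmono hij)) ⟨?_, ?_⟩
    (fun i => (Y i).liftQ p (hle i)) ?_ ?_ ?_ ?_
  · intro i x
    obtain ⟨x, rfl⟩ := Submodule.mkQ_surjective _ x
    simp
  · intro k j i hij hjk x
    obtain ⟨x, rfl⟩ := Submodule.mkQ_surjective _ x
    simp
  · intro i j hij x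
    obtain ⟨x, rfl⟩ := Submodule.mkQ_surjective _ x
    simp
  · intro n
    obtain ⟨x, rfl⟩ := hp n
    exact ⟨i₀, (Y i₀).mkQ x, by simp⟩
  · intro i x hx
    obtain ⟨x, rfl⟩ := Submodule.mkQ_surjective _ x
    obtain ⟨j, hj⟩ := (hY x).1 (by simpa using hx)
    obtain ⟨k, hik, hjk⟩ := exists_ge_ge i j
    exact ⟨k, hik, by simpa using hmono hjk hj⟩
  · intro i
    obtain ⟨Q, _, _, q, h, hh, hq, hYq⟩ := hf i
    have : f.comp ((Y i).liftQ p (hle i)) = h.comp ((Y i).liftQ q hYq) := by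
      apply Submodule.linearMap_qext
      ext x
      simpa using (LinearMap.congr_fun hq x).symm
    rw [this]
    exact mem_comp hh _

/-- Criterion for `f : N → M` to stay in the ideal after dividing out `k ∈ ker f`: every finite
linear system over `N` with constants in `R k` has the same solutions over `M` as its homogeneous
version. -/
theorem ClosedUnderDirectLimits.mem_liftQ_span_singleton (hI : I.ClosedUnderDirectLimits)
    {N M : Type u} [AddCommGroup N] [Module R N] [AddCommGroup M] [Module R M]
    {f : N →ₗ[R] M} (hf : I.mem f) (k : N) (hk : Submodule.span R {k} ≤ LinearMap.ker f)
    (h : ∀ (r : Finset ((ℕ →₀ R) × R)) (x : ℕ → N),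
      (∀ ρ ∈ r, Finsupp.linearCombination R x ρ.1 = ρ.2 • k) →
      ∃ y : ℕ → N, (∀ ρ ∈ r, Finsupp.linearCombination R y ρ.1 = 0) ∧ ∀ n, f (y n) = f (x n)) :
    I.mem ((Submodule.span R {k}).liftQ f hk) := by
  classical
  let p : (N →₀ R) →ₗ[R] N ⧸ Submodule.span R {k} :=
    (Submodule.span R {k}).mkQ.comp (Finsupp.linearCombination R id)
  have hker : ∀ y, p y = 0 → ∃ s : R, Finsupp.linearCombination R id y = s • k := fun y hy => by
    have : Finsupp.linearCombination R id y ∈ Submodule.span R {k} := by simpa [p] using hy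
    obtain ⟨s, hs⟩ := Submodule.mem_span_singleton.1 this
    exact ⟨s, hs.symm⟩
  choose! c hc using hker
  refine hI.mem_of_quotients (ι := Finset (LinearMap.ker p)) p
    ((Submodule.mkQ_surjective _).comp
      (Finsupp.linearCombination_surjective R Function.surjective_id))
    (fun s => Submodule.span R (Subtype.val '' (s : Set (LinearMap.ker p))))
    (fun s t hst => Submodule.span_mono (Set.image_mono hst)) (fun x => ⟨fun hx => ?_, ?_⟩)
    fun s => ?_
  · exact ⟨{⟨x, hx⟩}, Submodule.subset_span (by simp)⟩
  · rintro ⟨s, hs⟩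
    refine (Submodule.span_le (p := LinearMap.ker p)).2 ?_ hs
    rintro _ ⟨y, -, rfl⟩
    exact y.2
  · let X : Finset N := s.biUnion fun y => y.1.support
    obtain ⟨e, he⟩ := exists_injective_nat X
    let e' : N → ℕ := fun n => if hn : n ∈ X then e ⟨n, hn⟩ else 0
    have he' : Set.InjOn e' X := by
      intro a ha b hb hab
      simp only [Finset.mem_coe] at ha hb
      simp only [e', ha, hb, dif_pos] at hab
      exact congrArg Subtype.val (he hab)
    let x : ℕ → N := Function.invFunOn e' X
    have hx : ∀ n ∈ X, x (e' n) = n := fun n hn => he'.leftInvOn_invFunOn hn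
    have hlc : ∀ (z v : N → N) (y : LinearMap.ker p), y ∈ s → (∀ n ∈ X, z n = v n) →
        Finsupp.linearCombination R z y.1 = Finsupp.linearCombination R v y.1 := by
      intro z v y hy hzv
      simp only [Finsupp.linearCombination_apply, Finsupp.sum]
      refine Finset.sum_congr rfl fun n hn => ?_
      rw [hzv n (Finset.mem_biUnion.2 ⟨y, hy, hn⟩)]
    obtain ⟨y, hy0, hy⟩ := h (s.image fun y => (Finsupp.mapDomain e' y.1, c y.1)) x (by
      intro ρ hρ
      obtain ⟨y, hy, rfl⟩ := Finset.mem_image.1 hρ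
      rw [Finsupp.linearCombination_mapDomain, ← hc y.1 y.2]
      exact hlc _ _ y hy hx)
    let z : N → N := fun n => if n ∈ X then y (e' n) else n
    refine ⟨N, inferInstance, inferInstance, Finsupp.linearCombination R z, f, hf, ?_, ?_⟩
    · ext n
      by_cases hn : n ∈ X
      · simp [p, z, hn, hy, hx n hn]
      · simp [p, z, hn]
    · rw [Submodule.span_le]
      rintro _ ⟨w, hw, rfl⟩
      have := hy0 _ (Finset.mem_image_of_mem _ hw)
      rw [Finsupp.linearCombination_mapDomain] at this
      rw [SetLike.mem_coe, LinearMap.mem_ker, ← this]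
      exact hlc _ _ w hw fun n hn => by simp [z, hn]

/-- A member `f` of the ideal is rigid if `f = h ∘ g` with `h` in the ideal forces `g` to be
injective. -/
def IsRigid (I : ModuleIdeal R) {N M : Type u} [AddCommGroup N] [Module R N]
    [AddCommGroup M] [Module R M] (f : N →ₗ[R] M) : Prop :=
  I.mem f ∧ ∀ (Q : Type u) [AddCommGroup Q] [Module R Q] (g : N →ₗ[R] Q) (h : Q →ₗ[R] M),
    I.mem h → h.comp g = f → Function.Injective g

theorem ClosedUnderDirectLimits.exists_isRigid (hI : I.ClosedUnderDirectLimits)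
    {N M : Type u} [AddCommGroup N] [Module R N] [AddCommGroup M] [Module R M]
    {f : N →ₗ[R] M} (hf : I.mem f) :
    ∃ (Q : Type u) (_ : AddCommGroup Q) (_ : Module R Q) (g : N →ₗ[R] Q) (h : Q →ₗ[R] M),
      I.IsRigid h ∧ h.comp g = f := by
  let Z : Set (Submodule R N) := {K | ∃ h : K ≤ LinearMap.ker f, I.mem (K.liftQ f h)}
  have hZ : ∀ (Q : Type u) [AddCommGroup Q] [Module R Q] (g : N →ₗ[R] Q) (h : Q →ₗ[R] M),
      I.mem h → h.comp g = f → LinearMap.ker g ∈ Z := by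
    rintro Q _ _ g h hh rfl
    refine ⟨LinearMap.ker_le_ker_comp g h, ?_⟩
    convert mem_comp hh ((LinearMap.ker g).liftQ g le_rfl) using 1
    apply Submodule.linearMap_qext
    ext x
    simp
  obtain ⟨K, -, hK⟩ := zorn_le_nonempty₀ Z (fun C hCZ hC K₀ hK₀ => by
    have hdir : DirectedOn (· ≤ ·) C := hC.directedOn
    have : IsDirected C (· ≤ ·) := directedOn_iff_isDirectedOrder.1 hdir
    have hmem : ∀ x, x ∈ sSup C ↔ ∃ K : C, x ∈ K.1 := fun x => by
      rw [Submodule.mem_sSup_of_directed ⟨K₀, hK₀⟩ hdir]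
      simp
    have hle : sSup C ≤ LinearMap.ker f := sSup_le fun K hK => (hCZ hK).1
    refine ⟨sSup C, ⟨hle, ?_⟩, fun K hK => le_sSup hK⟩
    refine hI.mem_of_quotients (ι := C) (sSup C).mkQ (Submodule.mkQ_surjective _) (fun K => K.1)
      (fun _ _ h => h) (fun x => by rw [← hmem]; simp) fun K => ?_
    obtain ⟨hKf, hKI⟩ := hCZ K.2
    exact ⟨_, _, _, K.1.mkQ, _, hKI, by simp, by simp⟩) ⊥ (by
    simpa using hZ N LinearMap.id f hf (LinearMap.comp_id f))
  obtain ⟨hKf, hKI⟩ := hK.prop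
  refine ⟨_, _, _, K.mkQ, K.liftQ f hKf, ⟨hKI, fun Q _ _ g h hh hgh => ?_⟩, K.liftQ_mkQ f hKf⟩
  have hle : LinearMap.ker (g.comp K.mkQ) ≤ K :=
    hK.le_of_ge (hZ Q (g.comp K.mkQ) h hh (by rw [← LinearMap.comp_assoc, hgh, K.liftQ_mkQ]))
      fun x hx => by simp [(Submodule.Quotient.mk_eq_zero K).2 hx]
  refine (injective_iff_map_eq_zero g).2 fun x hx => ?_
  obtain ⟨x, rfl⟩ := K.mkQ_surjective x
  simpa using hle hx

end ModuleIdeal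

/-- A character of `A` vanishing on the kernel of `g : A → B` comes from a character of `B`. -/
theorem CharacterModule.exists_comp_eq {A B : Type*} [AddCommGroup A] [AddCommGroup B]
    (g : A →+ B) (χ : CharacterModule A) (hχ : ∀ a, g a = 0 → χ a = 0) :
    ∃ ψ : CharacterModule B, ∀ a, ψ (g a) = χ a := by
  let g' : A →ₗ[ℤ] B := g.toIntLinearMap
  obtain ⟨ψ, hψ⟩ := CharacterModule.dual_surjective_of_injective
    ((LinearMap.ker g').liftQ g' le_rfl) (LinearMap.ker_eq_bot.1 (Submodule.ker_liftQ_eq_bot' _ _ rfl))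
    (((LinearMap.ker g').liftQ (AddMonoidHom.toIntLinearMap χ) fun a ha => hχ a ha).toAddMonoidHom)
  exact ⟨ψ, fun a => DFunLike.congr_fun hψ (Submodule.Quotient.mk a)⟩

namespace ModuleIdeal

variable {R : Type u} [Ring R] {I : ModuleIdeal R}

/-- The domains of rigid morphisms to `M` have bounded size. -/
theorem ClosedUnderDirectLimits.exists_bound_isRigid (hI : I.ClosedUnderDirectLimits)
    (M : Type u) [AddCommGroup M] [Module R M] :
    ∃ W : Type u, Nonempty W ∧ ∀ (N : Type u) [AddCommGroup N] [Module R N] (f : N →ₗ[R] M),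
      I.IsRigid f → ∃ w : N → W, Function.Injective w := by
  let T : Type u := Finset ((ℕ →₀ R) × R) × CharacterModule (ℕ → M) → AddCircle (1 : ℚ)
  refine ⟨M × T, ⟨(0, fun _ => 0)⟩, fun N _ _ f hf => ?_⟩
  have hψ : ∀ t : Finset ((ℕ →₀ R) × R) × CharacterModule (ℕ → M),
      ∃ ψ : CharacterModule N,
        (∀ y : ℕ → N, (∀ ρ ∈ t.1, Finsupp.linearCombination R y ρ.1 = 0) → t.2 (f ∘ y) = 0) →
        ∀ (k : N) (x : ℕ → N), (∀ ρ ∈ t.1, Finsupp.linearCombination R x ρ.1 = ρ.2 • k) →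
          ψ k = t.2 (f ∘ x) := by
    rintro ⟨r, χ⟩
    by_cases hr : ∀ y : ℕ → N, (∀ ρ ∈ r, Finsupp.linearCombination R y ρ.1 = 0) → χ (f ∘ y) = 0
    swap
    · exact ⟨0, fun h => absurd h hr⟩
    have hadd : ∀ (x y : ℕ → N) (ρ : ℕ →₀ R), Finsupp.linearCombination R (x + y) ρ =
        Finsupp.linearCombination R x ρ + Finsupp.linearCombination R y ρ := fun x y ρ => by
      simp [Finsupp.linearCombination_apply, Finsupp.sum_add]
    let E : AddSubgroup (N × (ℕ → N)) :=
      { carrier := {z | ∀ ρ ∈ r, Finsupp.linearCombination R z.2 ρ.1 = ρ.2 • z.1}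
        zero_mem' := fun ρ _ => by simp
        add_mem' := fun {a b} ha hb ρ hρ => by
          simp [hadd, ha ρ hρ, hb ρ hρ]
        neg_mem' := fun {a} ha ρ hρ => by
          have := ha ρ hρ
          simp only [Finsupp.linearCombination_apply] at this
          simp [Finsupp.linearCombination_apply, this] }
    let fN : (ℕ → N) →+ (ℕ → M) := f.toAddMonoidHom.compLeft ℕ
    obtain ⟨ψ, hψ⟩ := CharacterModule.exists_comp_eq ((AddMonoidHom.fst N (ℕ → N)).comp E.subtype)
      (AddMonoidHom.comp χ (fN.comp ((AddMonoidHom.snd N (ℕ → N)).comp E.subtype))) (by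
        rintro ⟨⟨k, x⟩, hx⟩ hk
        replace hk : k = 0 := hk
        subst hk
        exact hr x fun ρ hρ => by simpa using hx ρ hρ)
    exact ⟨ψ, fun _ k x hx => hψ ⟨(k, x), hx⟩⟩
  choose ψ hψ using hψ
  refine ⟨fun n => (f n, fun t => ψ t n), fun a b hab => ?_⟩
  obtain ⟨h1, h2⟩ := Prod.mk.inj hab
  let k := a - b
  have hk0 : f k = 0 := by simp [k, h1]
  have hk : Submodule.span R {k} ≤ LinearMap.ker f := by
    simpa [Submodule.span_le] using hk0
  have hψk : ∀ t, ψ t k = 0 := fun t => by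
    have := congrFun h2 t
    exact (AddMonoidHom.map_sub (ψ t) a b).trans (sub_eq_zero.2 this)
  have hmem := hI.mem_liftQ_span_singleton hf.1 k hk fun r x hx => by
    let H : AddSubgroup (ℕ → M) :=
      { carrier := {m | ∃ y : ℕ → N, (∀ ρ ∈ r, Finsupp.linearCombination R y ρ.1 = 0) ∧ f ∘ y = m}
        zero_mem' := ⟨0, fun ρ _ => by simp, by ext; simp⟩
        add_mem' := by
          rintro _ _ ⟨y, hy, rfl⟩ ⟨z, hz, rfl⟩
          refine ⟨y + z, fun ρ hρ => ?_, by ext; simp⟩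
          have h1 := hy ρ hρ
          have h2 := hz ρ hρ
          simp only [Finsupp.linearCombination_apply] at h1 h2
          simp [Finsupp.linearCombination_apply, Finsupp.sum_add, h1, h2]
        neg_mem' := by
          rintro _ ⟨y, hy, rfl⟩
          refine ⟨-y, fun ρ hρ => ?_, by ext; simp⟩
          have h1 := hy ρ hρ
          simp only [Finsupp.linearCombination_apply] at h1
          simp [Finsupp.linearCombination_apply, h1] }
    suffices f ∘ x ∈ H by
      obtain ⟨y, hy, hyx⟩ := this
      exact ⟨y, hy, congrFun hyx⟩
    rw [← QuotientAddGroup.eq_zero_iff]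
    refine CharacterModule.eq_zero_of_character_apply fun c => ?_
    let χ : CharacterModule (ℕ → M) := AddMonoidHom.comp c (QuotientAddGroup.mk' H)
    have hχ : χ (f ∘ x) = 0 := by
      rw [← hψ (r, χ) (fun y hy => ?_) k x hx, hψk]
      have : (QuotientAddGroup.mk' H) (f ∘ y) = 0 := (QuotientAddGroup.eq_zero_iff _).2 ⟨y, hy, rfl⟩
      exact (congrArg c this).trans (map_zero c)
    exact hχ
  have hinj := hf.2 _ (Submodule.span R {k}).mkQ _ hmem (Submodule.liftQ_mkQ _ _ _)
  have : k = 0 := hinj (by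
    simp [(Submodule.Quotient.mk_eq_zero _).2 (Submodule.mem_span_singleton_self k)])
  exact sub_eq_zero.1 this

/-- A rigid morphism to `M` whose domain is carried by a subset of the type `V`. -/
structure RigidOn (I : ModuleIdeal R) (M : Type u) [AddCommGroup M] [Module R M] (V : Type u) where
  carrier : Set V
  [group : AddCommGroup carrier]
  [module : Module R carrier]
  hom : carrier →ₗ[R] M
  isRigid : I.IsRigid hom

namespace RigidOn

attribute [instance] RigidOn.group RigidOn.module

variable {M : Type u} [AddCommGroup M] [Module R M] {V : Type u}

instance : Preorder (RigidOn I M V) where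
  le s t := ∃ φ : s.carrier →ₗ[R] t.carrier, t.hom.comp φ = s.hom ∧ ∀ x, (φ x : V) = x
  le_refl s := ⟨LinearMap.id, rfl, fun _ => rfl⟩
  le_trans s t v := by
    rintro ⟨φ, hφ, hφ'⟩ ⟨ψ, hψ, hψ'⟩
    exact ⟨ψ.comp φ, by rw [← LinearMap.comp_assoc, hψ, hφ], fun x => by simp [hψ', hφ']⟩

theorem le_def {s t : RigidOn I M V} : s ≤ t ↔
    ∃ φ : s.carrier →ₗ[R] t.carrier, t.hom.comp φ = s.hom ∧ ∀ x, (φ x : V) = x := Iff.rfl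

/-- A rigid morphism whose domain embeds in `V` can be carried over to the image. -/
theorem exists_of_injective {L : Type u} [AddCommGroup L] [Module R L] {f : L →ₗ[R] M}
    (hf : I.IsRigid f) (e : L → V) (he : Function.Injective e) :
    ∃ (t : RigidOn I M V) (E : L ≃ₗ[R] t.carrier), t.hom.comp (E : L →ₗ[R] t.carrier) = f ∧
      ∀ x, (E x : V) = e x := by
  let e' := (Equiv.ofInjective e he).symm
  let _ : AddCommGroup (Set.range e) := e'.addCommGroup
  let _ : Module R (Set.range e) := e'.module R
  let E : L ≃ₗ[R] Set.range e := (e'.linearEquiv R).symm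
  refine ⟨{ carrier := Set.range e
            hom := f.comp (E.symm : Set.range e →ₗ[R] L)
            isRigid := ⟨mem_comp hf.1 _, fun Q _ _ g h hh hgh => ?_⟩ }, E, ?_, fun x => rfl⟩
  · have := hf.2 Q (g.comp (E : L →ₗ[R] Set.range e)) h hh (by
      rw [← LinearMap.comp_assoc, hgh]
      ext x
      simp)
    intro a b hab
    apply E.symm.injective
    exact this (by simpa using hab)
  · ext x
    simp

theorem bddAbove_of_isChain (hI : I.ClosedUnderDirectLimits) {C : Set (RigidOn I M V)}
    (hC : IsChain (· ≤ ·) C) (hne : C.Nonempty) : BddAbove C := by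
  classical
  have : Nonempty C := hne.to_subtype
  have : IsDirected C (· ≤ ·) := directedOn_iff_isDirectedOrder.1 hC.directedOn
  let G : C → Type u := fun i => i.1.carrier
  have hle : ∀ i j : C, i ≤ j →
      ∃ φ : G i →ₗ[R] G j, j.1.hom.comp φ = i.1.hom ∧ ∀ x, (φ x).1 = x.1 := fun i j h => h
  choose g hg hgv using hle
  have sys : DirectedSystem G fun i j hij => g i j hij :=
    ⟨fun i x => Subtype.ext (hgv _ _ _ _), fun k j i hij hjk x => Subtype.ext (by
      rw [hgv, hgv, hgv])⟩
  let of := Module.DirectLimit.of R C G g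
  have hginj : ∀ i j hij, Function.Injective (g i j hij) := fun i j hij x y h =>
    Subtype.ext (by rw [← hgv i j hij, h, hgv])
  let f : Module.DirectLimit G g →ₗ[R] M := Module.DirectLimit.lift R C G g (fun i => i.1.hom)
    fun i j hij x => LinearMap.congr_fun (hg i j hij) x
  have hf : ∀ i, f.comp (of i) = i.1.hom := fun i => by ext x; simp [f, of]
  have hval : ∀ i j (x : G i) (y : G j), of i x = of j y ↔ x.1 = y.1 := by
    intro i j x y
    obtain ⟨k, hik, hjk⟩ := exists_ge_ge i j
    constructor
    · intro h
      rw [← Module.DirectLimit.of_f (hij := hik), ← Module.DirectLimit.of_f (hij := hjk),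
        ← sub_eq_zero, ← map_sub] at h
      obtain ⟨l, hkl, h0⟩ := Module.DirectLimit.of.zero_exact h
      have := sub_eq_zero.1 (hginj _ _ _ (h0.trans (map_zero _).symm))
      rw [← hgv i k hik, this, hgv]
    · intro h
      simp only [of]
      rw [← Module.DirectLimit.of_f (hij := hik), ← Module.DirectLimit.of_f (hij := hjk)]
      exact congrArg _ (Subtype.ext (by rw [hgv, hgv, h]))
  have hrigid : I.IsRigid f := by
    refine ⟨hI.mem_of_directLimit g sys of (fun i j hij x => Module.DirectLimit.of_f)
      Module.DirectLimit.exists_of (fun i x => Module.DirectLimit.of.zero_exact)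
      fun i => by rw [hf]; exact i.1.isRigid.1, fun Q _ _ q h hh hqh => ?_⟩
    refine (injective_iff_map_eq_zero q).2 fun z hz => ?_
    obtain ⟨i, x, rfl⟩ := Module.DirectLimit.exists_of z
    have := i.1.isRigid.2 Q (q.comp (of i)) h hh (by rw [← LinearMap.comp_assoc, hqh, hf])
    rw [this (hz.trans (map_zero _).symm : q.comp (of i) x = q.comp (of i) 0), map_zero]
  have hrep : ∀ z, ∃ v : V, ∃ i, ∃ x : G i, of i x = z ∧ x.1 = v := fun z => by
    obtain ⟨i, x, h⟩ := Module.DirectLimit.exists_of z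
    exact ⟨x.1, i, x, h, rfl⟩
  choose e he using hrep
  have hinj : Function.Injective e := fun a b hab => by
    obtain ⟨i, x, hx, hxv⟩ := he a
    obtain ⟨j, y, hy, hyv⟩ := he b
    rw [← hx, ← hy]
    exact (hval i j x y).2 (by rw [hxv, hyv, hab])
  obtain ⟨t, E, htE, hE⟩ := exists_of_injective hrigid e hinj
  refine ⟨t, fun s hs => le_def.2 ⟨(E : _ →ₗ[R] t.carrier).comp (of ⟨s, hs⟩), ?_, fun x => ?_⟩⟩
  · rw [← LinearMap.comp_assoc, htE, hf]
  · obtain ⟨j, y, hy, hyv⟩ := he (of ⟨s, hs⟩ x)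
    rw [LinearMap.comp_apply, LinearEquiv.coe_coe, hE, ← hyv]
    exact (hval _ _ _ _).1 hy

end RigidOn

/-- There is a rigid morphism to `M` admitting no proper map to another rigid morphism. -/
theorem ClosedUnderDirectLimits.exists_maximal_isRigid (hI : I.ClosedUnderDirectLimits)
    (M : Type u) [AddCommGroup M] [Module R M] :
    ∃ (F : Type u) (_ : AddCommGroup F) (_ : Module R F) (i : F →ₗ[R] M), I.IsRigid i ∧
      ∀ (Q : Type u) [AddCommGroup Q] [Module R Q] (φ : F →ₗ[R] Q) (h : Q →ₗ[R] M),
        I.IsRigid h → h.comp φ = i → Function.Surjective φ := by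
  classical
  obtain ⟨W, ⟨w₀⟩, hW⟩ := hI.exists_bound_isRigid M
  have hne : Nonempty (RigidOn I M (W × Set W)) := by
    obtain ⟨Q, _, _, g, h, hh, -⟩ := hI.exists_isRigid (I.zero_mem (M := PUnit.{u + 1}) (N := M))
    obtain ⟨w, hw⟩ := hW Q h hh
    obtain ⟨t, -⟩ := RigidOn.exists_of_injective hh (fun q => (w q, (∅ : Set W)))
      fun a b hab => hw (Prod.mk.inj hab).1
    exact ⟨t⟩
  obtain ⟨m, hm⟩ := zorn_le_nonempty fun (C : Set (RigidOn I M (W × Set W))) hC hCne =>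
    RigidOn.bddAbove_of_isChain hI hC hCne
  refine ⟨m.carrier, _, _, m.hom, m.isRigid, fun Q _ _ φ h hh hφ => ?_⟩
  have hφinj : Function.Injective φ := m.isRigid.2 Q φ h hh.1 hφ
  obtain ⟨wm, hwm⟩ := hW _ m.hom m.isRigid
  obtain ⟨w, hw⟩ := hW Q h hh
  obtain ⟨a, ha⟩ : ∃ a : Set W, ∀ x : m.carrier, x.1.2 ≠ a := by
    by_contra! hall
    choose x hx using hall
    refine Function.cantor_injective (fun a => wm (x a)) fun a b hab => ?_
    rw [← hx a, ← hx b, hwm hab]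
  let e : Q → W × Set W := fun q => if hq : ∃ x, φ x = q then hq.choose.1 else (w q, a)
  have heφ : ∀ x, e (φ x) = x.1 := fun x => by
    have hq : ∃ y, φ y = φ x := ⟨x, rfl⟩
    simp only [e, dif_pos hq]
    rw [hφinj hq.choose_spec]
  have hen : ∀ q, (¬ ∃ x, φ x = q) → e q = (w q, a) := fun q hq => dif_neg hq
  have heinj : Function.Injective e := fun q q' hqq' => by
    by_cases hq : ∃ x, φ x = q <;> by_cases hq' : ∃ x, φ x = q'
    · obtain ⟨x, rfl⟩ := hq
      obtain ⟨y, rfl⟩ := hq'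
      rw [heφ, heφ] at hqq'
      rw [Subtype.ext hqq']
    · obtain ⟨x, rfl⟩ := hq
      rw [heφ, hen _ hq'] at hqq'
      exact absurd (congrArg Prod.snd hqq') (ha x)
    · obtain ⟨y, rfl⟩ := hq'
      rw [heφ, hen _ hq] at hqq'
      exact absurd (congrArg Prod.snd hqq').symm (ha y)
    · rw [hen _ hq, hen _ hq'] at hqq'
      exact hw (congrArg Prod.fst hqq')
  obtain ⟨t, E, htE, hE⟩ := RigidOn.exists_of_injective hh e heinj
  obtain ⟨ψ, -, hψ⟩ := RigidOn.le_def.1 (hm (RigidOn.le_def.2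
    ⟨(E : Q →ₗ[R] t.carrier).comp φ, by rw [← LinearMap.comp_assoc, htE, hφ],
      fun x => by simp [hE, heφ]⟩))
  exact fun q => ⟨ψ (E q), heinj (by rw [heφ, hψ, hE])⟩

/-- Every ideal closed under direct limits is covering. -/
theorem ClosedUnderDirectLimits.exists_isCover (hI : I.ClosedUnderDirectLimits)
    (M : Type u) [AddCommGroup M] [Module R M] :
    ∃ (F : Type u) (_ : AddCommGroup F) (_ : Module R F) (i : F →ₗ[R] M), I.IsCover i := by
  obtain ⟨F, _, _, i, hi, hmax⟩ := hI.exists_maximal_isRigid M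
  refine ⟨F, _, _, i, ⟨hi.1, fun F' _ _ i' hi' => ?_⟩,
    fun j hj => ⟨hi.2 F j i hi.1 hj, hmax F j i hi hj⟩⟩
  have hsum : I.mem (i.coprod i') := by
    rw [LinearMap.coprod]
    exact I.add_mem (mem_comp hi.1 _) (mem_comp hi' _)
  obtain ⟨Q, _, _, g, h, hh, hg⟩ := hI.exists_isRigid hsum
  have hφ : h.comp (g.comp (LinearMap.inl R F F')) = i := by
    rw [← LinearMap.comp_assoc, hg, LinearMap.coprod_inl]
  let E := LinearEquiv.ofBijective (g.comp (LinearMap.inl R F F'))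
    ⟨hi.2 Q _ h hh.1 hφ, hmax Q _ h hh hφ⟩
  refine ⟨(E.symm : Q →ₗ[R] F).comp (g.comp (LinearMap.inr R F F')), ?_⟩
  have hE : i.comp (E.symm : Q →ₗ[R] F) = h := by
    ext q
    obtain ⟨x, rfl⟩ := E.surjective q
    rw [LinearMap.comp_apply, LinearEquiv.coe_coe, LinearEquiv.symm_apply_apply]
    exact (LinearMap.congr_fun hφ x).symm
  rw [← LinearMap.comp_assoc, hE, ← LinearMap.comp_assoc, hg, LinearMap.coprod_inr]

end ModuleIdeal

/-- **Theorem (Estrada–Guil Asensio–Ozbek).** Let `𝓘` be an ideal of `R`-Mod closed under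
direct limits. If `𝓘` is the closure under direct limits of a set of morphisms
`𝓘₀ = {σ s} ⊆ 𝓘`, then `𝓘` is a covering ideal: every left `R`-module has an `𝓘`-cover. -/
theorem covering_of_closure_of_set_under_direct_limits
    {R : Type u} [Ring R] (I : ModuleIdeal R)
    (hclosed : I.ClosedUnderDirectLimits)
    (S : Type u) (A B : S → Type u)
    [∀ s, AddCommGroup (A s)] [∀ s, Module R (A s)]
    [∀ s, AddCommGroup (B s)] [∀ s, Module R (B s)]
    (σ : ∀ s, A s →ₗ[R] B s)
    (hσ : ∀ s, I.mem (σ s))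
    (hclosure : ∀ (M N : Type u) [AddCommGroup M] [AddCommGroup N] [Module R M] [Module R N]
      (f : M →ₗ[R] N), I.mem f → Nonempty (DirectLimitPresentation R f A B σ))
    (M : Type u) [AddCommGroup M] [Module R M] :
    ∃ (F : Type u) (_ : AddCommGroup F) (_ : Module R F) (i : F →ₗ[R] M), I.IsCover i :=
  hclosed.exists_isCover M
end

section
/- Let R be a ring and let 𝓘 be an ideal of R-Mod that is closed under direct limits. If a left R-module M has an 𝓘-precover, then M has an 𝓘-cover. -/
universe u

namespace ModuleIdeal

variable {R : Type u} [Ring R] {I : ModuleIdeal R}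
  {M F : Type u} [AddCommGroup M] [Module R M] [AddCommGroup F] [Module R F]

theorem mem_comp_left (I : ModuleIdeal R) {N : Type u} [AddCommGroup N] [Module R N]
    {f : F →ₗ[R] N} (h : N →ₗ[R] M) (hf : I.mem f) : I.mem (h ∘ₗ f) := by
  simpa using I.comp_mem h LinearMap.id hf

theorem mem_comp_right (I : ModuleIdeal R) {N : Type u} [AddCommGroup N] [Module R N]
    {f : N →ₗ[R] M} (t : F →ₗ[R] N) (hf : I.mem f) : I.mem (f ∘ₗ t) := by
  simpa using I.comp_mem LinearMap.id t hf

/-- If `I` is closed under direct limits, then a direct limit of morphisms of `I` with common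
target `M` is again in `I`. -/
theorem ClosedUnderDirectLimits.mem_lift (hI : I.ClosedUnderDirectLimits)
    {ι : Type u} [Preorder ι] [IsDirected ι (· ≤ ·)] [DecidableEq ι]
    {G : ι → Type u} [∀ k, AddCommGroup (G k)] [∀ k, Module R (G k)]
    {g : ∀ k l, k ≤ l → G k →ₗ[R] G l} (hg : DirectedSystem G (fun k l hkl => g k l hkl))
    (p : ∀ k, G k →ₗ[R] M) (hp : ∀ k l (hkl : k ≤ l) x, p l (g k l hkl x) = p k x)
    (hmem : ∀ k, I.mem (p k)) :
    I.mem (Module.DirectLimit.lift R ι G g p hp) := by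
  let h : ∀ k l : ι, k ≤ l → M →ₗ[R] M := fun _ _ _ => LinearMap.id
  have key := hI ι G (fun _ => M) g h hg
    ⟨fun _ _ => rfl, fun _ _ _ _ _ _ => rfl⟩ p
    (fun k l hkl => LinearMap.ext fun x => hp k l hkl x) hmem
    (Module.DirectLimit.lift R ι G g
      (fun k => Module.DirectLimit.of R ι (fun _ => M) h k ∘ₗ p k)
      (fun k l hkl x => by
        simp only [LinearMap.comp_apply, hp]
        exact Module.DirectLimit.of_f (f := h) (hij := hkl) (x := p k x)))
    (fun k x => by simp)
  convert I.mem_comp_left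
    (Module.DirectLimit.lift R ι (fun _ => M) h (fun _ => LinearMap.id) fun _ _ _ _ => rfl) key
  refine Module.DirectLimit.hom_ext fun k => LinearMap.ext fun x => ?_
  simp

theorem IsPrecover.exists_cocone (hI : I.ClosedUnderDirectLimits) {i : F →ₗ[R] M}
    (hi : I.IsPrecover i) {ι : Type u} [LinearOrder ι] (c : ι → ι → F →ₗ[R] F)
    (hc : ∀ k l, k < l → i ∘ₗ c l k = i)
    (hcomp : ∀ k l m, k < l → l < m → c m l ∘ₗ c l k = c m k) :
    ∃ d : ι → F →ₗ[R] F, (∀ k, i ∘ₗ d k = i) ∧ ∀ k l, k < l → d l ∘ₗ c l k = d k := by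
  let g : ∀ k l : ι, k ≤ l → F →ₗ[R] F := fun k l _ => if k = l then LinearMap.id else c l k
  have g_self (k : ι) (h : k ≤ k) : g k k h = LinearMap.id := if_pos rfl
  have g_lt (k l : ι) (h : k < l) : g k l h.le = c l k := if_neg h.ne
  have hg : DirectedSystem (fun _ : ι => F) (fun k l hkl => g k l hkl) := by
    refine ⟨fun k x => by simp [g_self], fun m l k hkl hlm x => ?_⟩
    rcases hkl.eq_or_lt with rfl | hkl
    · simp [g_self]
    rcases hlm.eq_or_lt with rfl | hlm
    · simp [g_self]
    rw [g_lt _ _ hkl, g_lt _ _ hlm, g_lt _ _ (hkl.trans hlm), ← hcomp _ _ _ hkl hlm]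
    rfl
  have hp : ∀ k l (hkl : k ≤ l) x, i (g k l hkl x) = i x := by
    intro k l hkl x
    rcases hkl.eq_or_lt with rfl | hkl
    · simp [g_self]
    · rw [g_lt _ _ hkl]
      exact LinearMap.congr_fun (hc k l hkl) x
  obtain ⟨j, hj⟩ := hi.2 _ _ (hI.mem_lift hg (fun _ => i) hp fun _ => hi.1)
  refine ⟨fun k => j ∘ₗ Module.DirectLimit.of R ι (fun _ => F) g k, fun k => ?_,
    fun k l hkl => ?_⟩
  · rw [← LinearMap.comp_assoc, hj]
    ext x
    simp
  · ext x
    have := Module.DirectLimit.of_f (f := g) (hij := hkl.le) (x := x)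
    rw [g_lt _ _ hkl] at this
    simp [this]

/-- Over an ideal closed under direct limits, a precover with an endomorphism over `M` that is
not surjective admits chains of such endomorphisms along any well-order. -/
theorem IsPrecover.exists_chain (hI : I.ClosedUnderDirectLimits) {i : F →ₗ[R] M}
    (hi : I.IsPrecover i) {f : F →ₗ[R] F} (hf : i ∘ₗ f = i) (hsurj : ¬ Function.Surjective f)
    (ι : Type u) [LinearOrder ι] [WellFoundedLT ι] :
    ∃ c : ι → ι → F →ₗ[R] F, ∀ m, ∀ k < m, i ∘ₗ c m k = i ∧
      ¬ Function.Surjective (c m k) ∧ ∀ l < k, c m k ∘ₗ c k l = c m l := by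
  classical
  let P (m : ι) (prev : ∀ k, k < m → ι → F →ₗ[R] F) (d : ι → F →ₗ[R] F) : Prop :=
    ∀ k (hk : k < m), i ∘ₗ d k = i ∧ ¬ Function.Surjective (d k) ∧
      ∀ l < k, d k ∘ₗ prev k hk l = d l
  let step (m : ι) (prev : ∀ k, k < m → ι → F →ₗ[R] F) : ι → F →ₗ[R] F :=
    if h : ∃ d, P m prev d then h.choose else 0
  let c : ι → ι → F →ₗ[R] F := (wellFounded_lt (α := ι)).fix step
  refine ⟨c, fun m => ?_⟩
  induction m using WellFoundedLT.induction with
  | ind m ih =>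
  have hex : ∃ d, P m (fun k _ => c k) d := by
    obtain ⟨d, hd, hdc⟩ := hi.exists_cocone hI (ι := Set.Iio m) (fun k l => c k l)
      (fun k l hkl => (ih l l.2 k hkl).1)
      (fun k l n hkl hln => (ih n n.2 l hln).2.2 k hkl)
    refine ⟨fun k => if hk : k < m then f ∘ₗ d ⟨k, hk⟩ else 0, fun k hk => ?_⟩
    simp only [dif_pos hk]
    refine ⟨by rw [← LinearMap.comp_assoc, hf, hd], fun h => hsurj ?_, fun l hl => ?_⟩
    · rw [LinearMap.coe_comp] at h
      exact h.of_comp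
    · rw [dif_pos (hl.trans hk), LinearMap.comp_assoc]
      exact congrArg (f ∘ₗ ·) (hdc ⟨l, hl.trans hk⟩ ⟨k, hk⟩ hl)
  have hcm : c m = hex.choose := by
    rw [show c m = step m (fun k _ => c k) from WellFounded.fix_eq _ _ _]
    exact dif_pos hex
  rw [hcm]
  exact hex.choose_spec

theorem IsPrecover.isCover_of_injective (hI : I.ClosedUnderDirectLimits) {i : F →ₗ[R] M}
    (hi : I.IsPrecover i) (hinj : ∀ j : F →ₗ[R] F, i ∘ₗ j = i → Function.Injective j) :
    I.IsCover i := by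
  refine ⟨hi, fun f hf => ⟨hinj f hf, ?_⟩⟩
  by_contra hsurj
  obtain ⟨ι, hι⟩ : ∃ ι : Type u, ∀ φ : ι → Submodule R F, ¬ Function.Injective φ :=
    ⟨Set (Submodule R F), Function.cantor_injective⟩
  obtain ⟨_, _⟩ := exists_wellFoundedLT ι
  obtain ⟨c, hc⟩ := hi.exists_chain hI hf hsurj ι
  obtain ⟨d, hd, hdc⟩ := hi.exists_cocone hI c (fun k l hkl => (hc l k hkl).1)
    (fun k l m hkl hlm => (hc m l hlm).2.2 k hkl)
  have hne : ∀ k l, k < l → (d k).range ≠ (d l).range := by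
    intro k l hkl h
    refine (hc l k hkl).2.1 fun y => ?_
    obtain ⟨x, hx⟩ : d l y ∈ (d k).range := h ▸ LinearMap.mem_range_self (d l) y
    refine ⟨x, hinj _ (hd l) ?_⟩
    rw [← hx, ← hdc k l hkl]
    rfl
  refine hι (fun k => (d k).range) fun k l h => ?_
  rcases lt_trichotomy k l with hkl | hkl | hkl
  · exact (hne k l hkl h).elim
  · exact hkl
  · exact (hne l k hkl h.symm).elim

theorem ClosedUnderDirectLimits.exists_maximal_quotient (hI : I.ClosedUnderDirectLimits)
    {i : F →ₗ[R] M} (hi : I.mem i) :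
    ∃ K : Submodule R F, Maximal (fun K => ∃ p : F ⧸ K →ₗ[R] M, p ∘ₗ K.mkQ = i ∧ I.mem p) K := by
  classical
  let S : Set (Submodule R F) := {K | ∃ p : F ⧸ K →ₗ[R] M, p ∘ₗ K.mkQ = i ∧ I.mem p}
  suffices h : ∀ C ⊆ S, IsChain (· ≤ ·) C → ∀ K ∈ C, ∃ U ∈ S, ∀ K ∈ C, K ≤ U by
    obtain ⟨K, -, hK⟩ := zorn_le_nonempty₀ S h ⊥ ⟨(⊥ : Submodule R F).liftQ i bot_le,
      Submodule.liftQ_mkQ _ _ _, by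
        convert I.mem_comp_right ((⊥ : Submodule R F).quotEquivOfEqBot rfl).toLinearMap hi
        ext x
        simp⟩
    exact ⟨K, hK⟩
  intro C hCS hC K₀ hK₀
  refine ⟨sSup C, ?_, fun K hK => le_sSup hK⟩
  have : IsDirected C (· ≤ ·) := ⟨fun a b => by
    rcases hC.total a.2 b.2 with h | h
    · exact ⟨b, h, le_rfl⟩
    · exact ⟨a, le_rfl, h⟩⟩
  choose p hpi hp using fun K : C => hCS K.2
  have hpi' (K : C) (x : F) : p K (Submodule.Quotient.mk x) = i x :=
    LinearMap.congr_fun (hpi K) x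
  let g (k l : C) (h : k ≤ l) : F ⧸ k.1 →ₗ[R] F ⧸ l.1 := Submodule.factor h
  have hg : DirectedSystem (fun k : C => F ⧸ k.1) (fun k l hkl => g k l hkl) := by
    refine ⟨fun k x => ?_, fun m l k hkl hlm x => ?_⟩ <;>
    · obtain ⟨x, rfl⟩ := Submodule.Quotient.mk_surjective _ x
      rfl
  have hpg : ∀ k l (hkl : k ≤ l) x, p l (g k l hkl x) = p k x := by
    intro k l hkl x
    obtain ⟨x, rfl⟩ := Submodule.Quotient.mk_surjective _ x
    rw [hpi']
    exact hpi' l x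
  let φ (k : C) : F →ₗ[R] Module.DirectLimit (fun k : C => F ⧸ k.1) g :=
    Module.DirectLimit.of R C (fun k : C => F ⧸ k.1) g k ∘ₗ k.1.mkQ
  have hφ_le (k l : C) (h : k ≤ l) : φ k = φ l := by
    ext x
    exact (Module.DirectLimit.of_f (f := g) (hij := h) (x := k.1.mkQ x)).symm
  have hφ (k l : C) : φ k = φ l := by
    obtain ⟨m, hkm, hlm⟩ := exists_ge_ge k l
    rw [hφ_le k m hkm, hφ_le l m hlm]
  have hker : sSup C ≤ (φ ⟨K₀, hK₀⟩).ker := sSup_le fun K hK x hx => by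
    rw [LinearMap.mem_ker, hφ _ ⟨K, hK⟩]
    simp [φ, (Submodule.Quotient.mk_eq_zero K).2 hx]
  refine ⟨_, ?_, I.mem_comp_right ((sSup C).liftQ _ hker) (hI.mem_lift hg p hpg hp)⟩
  rw [LinearMap.comp_assoc, Submodule.liftQ_mkQ]
  ext x
  simp [φ, hpi']

end ModuleIdeal

/-- If an ideal `𝓘` of `R`-Mod is closed under direct limits and a module `M` has an
`𝓘`-precover, then `M` has an `𝓘`-cover. -/
theorem cover_of_precover_of_closedUnderDirectLimits
    {R : Type u} [Ring R] (I : ModuleIdeal R)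
    (hclosed : I.ClosedUnderDirectLimits)
    (M : Type u) [AddCommGroup M] [Module R M]
    (F : Type u) [AddCommGroup F] [Module R F] (i : F →ₗ[R] M)
    (hpre : I.IsPrecover i) :
    ∃ (F' : Type u) (_ : AddCommGroup F') (_ : Module R F') (i' : F' →ₗ[R] M),
      I.IsCover i' := by
  obtain ⟨K, ⟨p, hpi, hp⟩, hmax⟩ := hclosed.exists_maximal_quotient hpre.1
  have hpre' : I.IsPrecover p := by
    refine ⟨hp, fun F' _ _ i' hi' => ?_⟩
    obtain ⟨j, hj⟩ := hpre.2 F' i' hi'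
    exact ⟨K.mkQ ∘ₗ j, by rw [← LinearMap.comp_assoc, hpi, hj]⟩
  refine ⟨F ⧸ K, inferInstance, inferInstance, p,
    hpre'.isCover_of_injective hclosed fun j hj => ?_⟩
  have hle : (j ∘ₗ K.mkQ).ker ≤ K := by
    refine hmax ⟨p ∘ₗ (j ∘ₗ K.mkQ).ker.liftQ (j ∘ₗ K.mkQ) le_rfl, ?_, I.mem_comp_right _ hp⟩
      fun x hx => ?_
    · rw [LinearMap.comp_assoc, Submodule.liftQ_mkQ, ← LinearMap.comp_assoc, hj, hpi]
    · simp [(Submodule.Quotient.mk_eq_zero K).2 hx]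
  refine (injective_iff_map_eq_zero j).2 fun x hx => ?_
  obtain ⟨x, rfl⟩ := Submodule.Quotient.mk_surjective _ x
  exact (Submodule.Quotient.mk_eq_zero K).2 (hle hx)
end

section
/- Let R be a ring. Every left R-module M has a surjective phantom cover: there exists a surjective phantom morphism φ : F → M such that every phantom morphism ψ : G → M factors through φ, and every homomorphism j : F → F with φ ∘ j = φ is an automorphism of F. -/
universe u

/-- A morphism `f : M → N` of left `R`-modules is *phantom* if for every finitely presented
left `R`-module `L` and every homomorphism `g : L → M`, the composition `f ∘ g` factors
through a projective left `R`-module. -/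
def IsPhantom {R : Type u} [Ring R] {M N : Type u} [AddCommGroup M] [AddCommGroup N]
    [Module R M] [Module R N] (f : M →ₗ[R] N) : Prop :=
  ∀ (L : Type u) [AddCommGroup L] [Module R L] [Module.FinitePresentation R L]
    (g : L →ₗ[R] M),
    ∃ (P : Type u) (_ : AddCommGroup P) (_ : Module R P) (_ : Module.Projective R P)
      (α : L →ₗ[R] P) (β : P →ₗ[R] N), β.comp α = f.comp g

/-! ### Minimal idempotents in compact semigroups -/

/-- Ellis: a compact right topological semigroup `s` contains an idempotent `e` such that every
element of `e * s * e` has a left inverse in `e * s * e`. -/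
lemma exists_idempotent_forall_exists_left_inverse {S : Type*} [Semigroup S] [TopologicalSpace S]
    [T2Space S] (hmul : ∀ r : S, Continuous (· * r)) {s : Set S} (hs : IsCompact s)
    (hne : s.Nonempty) (hs_mul : ∀ x ∈ s, ∀ y ∈ s, x * y ∈ s) :
    ∃ e ∈ s, e * e = e ∧
      ∀ x ∈ s, e * x = x → x * e = x → ∃ y ∈ s, e * y = y ∧ y * e = y ∧ y * x = e := by
  let I : Set (Set S) := {L | L ⊆ s ∧ IsClosed L ∧ L.Nonempty ∧ ∀ x ∈ s, ∀ y ∈ L, x * y ∈ L}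
  obtain ⟨L, -, hL⟩ : ∃ L, L ⊆ s ∧ Minimal (· ∈ I) L := by
    refine zorn_superset_nonempty I (fun c hcI hc hcne => ?_) s
      ⟨subset_rfl, hs.isClosed, hne, hs_mul⟩
    refine ⟨⋂₀ c, ⟨?_, isClosed_sInter fun t ht => (hcI ht).2.1, ?_, ?_⟩,
      fun t ht => Set.sInter_subset_of_mem ht⟩
    · obtain ⟨t, ht⟩ := hcne
      exact (Set.sInter_subset_of_mem ht).trans (hcI ht).1
    · have := hcne.to_subtype
      rw [Set.sInter_eq_iInter]
      exact IsCompact.nonempty_iInter_of_directed_nonempty_isCompact_isClosed _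
        (DirectedOn.directed_val (IsChain.directedOn hc.symm)) (fun t => (hcI t.2).2.2.1)
        (fun t => hs.of_isClosed_subset (hcI t.2).2.1 (hcI t.2).1) (fun t => (hcI t.2).2.1)
    · exact fun x hx y hy t ht => (hcI ht).2.2.2 x hx y (hy t ht)
  obtain ⟨hLs, hLclosed, hLne, hLmul⟩ := hL.prop
  obtain ⟨e, heL, hee⟩ := exists_idempotent_in_compact_subsemigroup hmul L hLne
    (hs.of_isClosed_subset hLclosed hLs) fun x hx y hy => hLmul x (hLs hx) y hy
  refine ⟨e, hLs heL, hee, fun x hx hex hxe => ?_⟩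
  have hxL : x ∈ L := hxe ▸ hLmul x hx e heL
  have himage : (· * x) '' s = L := by
    apply hL.eq_of_subset
    · refine ⟨?_, (hs.image (hmul x)).isClosed, hne.image _, ?_⟩
      · rintro _ ⟨y, hy, rfl⟩
        exact hs_mul y hy x hx
      · rintro y hy _ ⟨z, hz, rfl⟩
        exact ⟨y * z, hs_mul y hy z hz, mul_assoc _ _ _⟩
    · rintro _ ⟨y, hy, rfl⟩
      exact hLmul y hy x hxL
  rw [← himage] at heL
  obtain ⟨y, hy, hyx : y * x = e⟩ := heL
  have hes : e ∈ s := hyx ▸ hs_mul y hy x hx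
  refine ⟨e * y * e, hs_mul _ (hs_mul e hes y hy) e hes, ?_, ?_, ?_⟩
  · rw [← mul_assoc, ← mul_assoc, hee]
  · rw [mul_assoc, hee]
  · rw [mul_assoc, hex, mul_assoc, hyx, hee]

/-! ### Morphisms with compact fibres -/

section CompactFibres

variable {R : Type u} [Ring R]

/-- A linear map that vanishes on the kernel of a surjection factors through it. -/
lemma LinearMap.exists_comp_eq_of_ker_le {X Y Z : Type*} [AddCommGroup X] [AddCommGroup Y]
    [AddCommGroup Z] [Module R X] [Module R Y] [Module R Z] (f : X →ₗ[R] Y)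
    (hf : Function.Surjective f) (g : X →ₗ[R] Z) (hfg : LinearMap.ker f ≤ LinearMap.ker g) :
    ∃ h : Y →ₗ[R] Z, h.comp f = g := by
  refine ⟨((LinearMap.ker f).liftQ g hfg).comp
    (f.quotKerEquivOfSurjective hf).symm.toLinearMap, LinearMap.ext fun x => ?_⟩
  have : (f.quotKerEquivOfSurjective hf).symm (f x) = Submodule.Quotient.mk x := by
    rw [LinearEquiv.symm_apply_eq]
    rfl
  simp [this]

variable {F G M : Type u} [AddCommGroup F] [Module R F] [AddCommGroup G] [Module R G]
  [AddCommGroup M] [Module R M]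

/-- The functions underlying linear lifts of `ψ` along `φ` are the pointwise lifts which respect
all linear relations. -/
lemma setOf_lifts_eq (φ : F →ₗ[R] M) (ψ : G →ₗ[R] M) :
    {f : G → F | ∃ h : G →ₗ[R] F, φ.comp h = ψ ∧ ⇑h = f} =
      Set.univ.pi (fun g => φ ⁻¹' {ψ g}) ∩
        ⋂ w : LinearMap.ker (Finsupp.linearCombination R (id : G → G)),
          {f : G → F | Finsupp.linearCombination R f (w : G →₀ R) = 0} := by
  ext f
  simp only [Set.mem_ofPred_eq, Set.mem_inter_iff, Set.mem_iInter, Set.mem_univ_pi,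
    Set.mem_preimage, Set.mem_singleton_iff]
  constructor
  · rintro ⟨h, hφ, rfl⟩
    refine ⟨fun g => LinearMap.congr_fun hφ g, fun ⟨w, hw⟩ => ?_⟩
    have := Finsupp.apply_linearCombination R h (id : G → G) w
    rw [LinearMap.mem_ker.1 hw, map_zero] at this
    exact this.symm
  · rintro ⟨hφ, hw⟩
    obtain ⟨h, hh⟩ := LinearMap.exists_comp_eq_of_ker_le
      (Finsupp.linearCombination R (id : G → G)) (Finsupp.linearCombination_id_surjective R G)
      (Finsupp.linearCombination R f) fun w hw' => hw ⟨w, hw'⟩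
    have hf : ∀ g, h g = f g := fun g => by
      simpa using LinearMap.congr_fun hh (Finsupp.single g 1)
    exact ⟨h, LinearMap.ext fun g => by simp [hf, hφ], funext hf⟩

/-- A phantom morphism lifts along a surjection after replacing its source by finitely many
elements subject to finitely many relations. -/
lemma IsPhantom.exists_finite_lift {φ : F →ₗ[R] M} (hsurj : Function.Surjective φ)
    {ψ : G →ₗ[R] M} (hψ : IsPhantom ψ)
    (u : Finset (LinearMap.ker (Finsupp.linearCombination R (id : G → G)))) :
    ∃ f : G → F, (∀ g, φ (f g) = ψ g) ∧
      ∀ w ∈ u, Finsupp.linearCombination R f (w : G →₀ R) = 0 := by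
  classical
  let S : Finset G := u.biUnion fun w => (w : G →₀ R).support
  let rel : LinearMap.ker (Finsupp.linearCombination R (id : G → G)) → (S →₀ R) :=
    fun w => (w : G →₀ R).subtypeDomain (· ∈ S)
  have hrel : ∀ w ∈ u, Finsupp.mapDomain Subtype.val (rel w) = (w : G →₀ R) := by
    intro w hw
    refine (Finsupp.embDomain_eq_mapDomain (Function.Embedding.subtype _) _).symm.trans ?_
    rw [← Finsupp.extendDomain_eq_embDomain_subtype]
    exact Finsupp.extendDomain_subtypeDomain _ fun g hg => Finset.mem_biUnion.2 ⟨w, hw, hg⟩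
  let N : Submodule R (S →₀ R) := Submodule.span R (rel '' u)
  have hcomb : ∀ {X : Type u} [AddCommGroup X] [Module R X] (f : G → X), ∀ w ∈ u,
      Finsupp.linearCombination R (fun g : S => f g) (rel w) =
        Finsupp.linearCombination R f (w : G →₀ R) := by
    intro X _ _ f w hw
    rw [← hrel w hw, Finsupp.linearCombination_mapDomain]
    rfl
  have hfp : Module.FinitePresentation R ((S →₀ R) ⧸ N) :=
    Module.finitePresentation_of_surjective N.mkQ N.mkQ_surjective (by
      rw [Submodule.ker_mkQ]
      exact Submodule.fg_span (u.finite_toSet.image _))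
  let q : ((S →₀ R) ⧸ N) →ₗ[R] G :=
    N.liftQ (Finsupp.linearCombination R (Subtype.val : S → G)) (by
      rw [Submodule.span_le]
      rintro _ ⟨w, hw, rfl⟩
      exact (hcomb id w hw).trans w.2)
  obtain ⟨P, _, _, _, α, β, hαβ⟩ := hψ _ q
  obtain ⟨γ, hγ⟩ := Module.projective_lifting_property φ β hsurj
  choose σ hσ using hsurj
  let h : S → F := fun g => γ (α (N.mkQ (Finsupp.single g 1)))
  let f : G → F := fun g => if hg : g ∈ S then h ⟨g, hg⟩ else σ (ψ g)
  have hfS : (fun g : S => f g) = h := funext fun g => by simp [f]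
  refine ⟨f, fun g => ?_, fun w hw => ?_⟩
  · by_cases hg : g ∈ S
    · have h1 := LinearMap.congr_fun hαβ (N.mkQ (Finsupp.single ⟨g, hg⟩ 1))
      have h2 := LinearMap.congr_fun hγ (α (N.mkQ (Finsupp.single ⟨g, hg⟩ 1)))
      simp only [LinearMap.comp_apply] at h1 h2
      simp only [f, dif_pos hg, h]
      rw [h2, h1]
      simp [q]
    · simp [f, dif_neg hg, hσ]
  · rw [← hcomb f w hw, hfS]
    have h1 : Finsupp.linearCombination R h = (γ.comp α).comp N.mkQ := by
      ext g
      simp [h]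
    rw [h1, LinearMap.comp_apply, Submodule.mkQ_apply,
      (Submodule.Quotient.mk_eq_zero N).2 (Submodule.subset_span ⟨w, hw, rfl⟩), map_zero]

variable [TopologicalSpace F] [T2Space F] [ContinuousAdd F] [ContinuousConstSMul R F]

lemma isClosed_setOf_linearCombination_eq_zero {G : Type u} (w : G →₀ R) :
    IsClosed {f : G → F | Finsupp.linearCombination R f w = 0} := by
  refine isClosed_eq ?_ continuous_const
  simp only [Finsupp.linearCombination_apply, Finsupp.sum]
  fun_prop

lemma isCompact_setOf_lifts {φ : F →ₗ[R] M} (hφ : ∀ m, IsCompact (φ ⁻¹' {m})) (ψ : G →ₗ[R] M) :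
    IsCompact {f : G → F | ∃ h : G →ₗ[R] F, φ.comp h = ψ ∧ ⇑h = f} := by
  rw [setOf_lifts_eq]
  exact (isCompact_univ_pi fun g => hφ _).inter_right
    (isClosed_iInter fun w => isClosed_setOf_linearCombination_eq_zero _)

/-- Phantom morphisms lift along surjections with compact fibres. -/
lemma IsPhantom.exists_lift {φ : F →ₗ[R] M} (hsurj : Function.Surjective φ)
    (hφ : ∀ m, IsCompact (φ ⁻¹' {m})) {ψ : G →ₗ[R] M} (hψ : IsPhantom ψ) :
    ∃ h : G →ₗ[R] F, φ.comp h = ψ := by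
  have : {f : G → F | ∃ h : G →ₗ[R] F, φ.comp h = ψ ∧ ⇑h = f}.Nonempty := by
    rw [setOf_lifts_eq]
    refine (isCompact_univ_pi fun g => hφ _).inter_iInter_nonempty _
      (fun w => isClosed_setOf_linearCombination_eq_zero _) fun u => ?_
    obtain ⟨f, hf, hfu⟩ := hψ.exists_finite_lift hsurj u
    exact ⟨f, fun g _ => hf g, Set.mem_iInter₂.2 hfu⟩
  obtain ⟨-, h, hh, -⟩ := this
  exact ⟨h, hh⟩

/-- A linear map with compact fibres admits an idempotent endomorphism `e` over its target such
that every endomorphism over the target fixed by `e` on both sides is left invertible relative to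
`e`. -/
lemma exists_idempotent_endomorphism {φ : F →ₗ[R] M} (hφ : ∀ m, IsCompact (φ ⁻¹' {m})) :
    ∃ e : F →ₗ[R] F, φ.comp e = φ ∧ e.comp e = e ∧
      ∀ j : F →ₗ[R] F, φ.comp j = φ → e.comp j = j → j.comp e = j →
        ∃ k : F →ₗ[R] F, φ.comp k = φ ∧ e.comp k = k ∧ k.comp e = k ∧ k.comp j = e := by
  let : TopologicalSpace (Function.End F) := inferInstanceAs (TopologicalSpace (F → F))
  have : T2Space (Function.End F) := inferInstanceAs (T2Space (F → F))
  obtain ⟨-, ⟨e, he, rfl⟩, hee, hinv⟩ := exists_idempotent_forall_exists_left_inverse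
    (S := Function.End F) (s := {f : F → F | ∃ j : F →ₗ[R] F, φ.comp j = φ ∧ ⇑j = f})
    (fun r => continuous_pi fun x => continuous_apply (r x)) (isCompact_setOf_lifts hφ φ)
    ⟨_, LinearMap.id, rfl, rfl⟩ (by
      rintro _ ⟨j, hj, rfl⟩ _ ⟨k, hk, rfl⟩
      exact ⟨j.comp k, by rw [← LinearMap.comp_assoc, hj, hk], rfl⟩)
  refine ⟨e, he, DFunLike.coe_injective hee, fun j hj hej hje => ?_⟩
  obtain ⟨-, ⟨k, hk, rfl⟩, hek, hke, hkj⟩ := hinv (⇑j : F → F) ⟨j, hj, rfl⟩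
    (congrArg DFunLike.coe hej) (congrArg DFunLike.coe hje)
  exact ⟨k, hk, DFunLike.coe_injective hek, DFunLike.coe_injective hke,
    DFunLike.coe_injective hkj⟩

end CompactFibres

/-- The restriction of a phantom morphism along any morphism is phantom. -/
lemma IsPhantom.comp {R : Type u} [Ring R] {M N G : Type u} [AddCommGroup M] [AddCommGroup N]
    [AddCommGroup G] [Module R M] [Module R N] [Module R G] {f : M →ₗ[R] N} (hf : IsPhantom f)
    (i : G →ₗ[R] M) : IsPhantom (f.comp i) :=
  fun L _ _ _ g => hf L (i.comp g)

/-- A surjective phantom morphism with compact fibres restricts to a phantom cover on a direct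
summand of its source. -/
lemma IsPhantom.exists_cover_of_isCompact_fibres {R : Type u} [Ring R] {F M : Type u}
    [AddCommGroup F] [Module R F] [AddCommGroup M] [Module R M] [TopologicalSpace F] [T2Space F]
    [ContinuousAdd F] [ContinuousConstSMul R F] {φ : F →ₗ[R] M} (hph : IsPhantom φ)
    (hsurj : Function.Surjective φ) (hφ : ∀ m, IsCompact (φ ⁻¹' {m})) :
    ∃ (E : Submodule R F), IsPhantom (φ.comp E.subtype) ∧
      Function.Surjective (φ.comp E.subtype) ∧
      (∀ (G : Type u) [AddCommGroup G] [Module R G] (ψ : G →ₗ[R] M),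
        IsPhantom ψ → ∃ h : G →ₗ[R] E, (φ.comp E.subtype).comp h = ψ) ∧
      (∀ j : E →ₗ[R] E, (φ.comp E.subtype).comp j = φ.comp E.subtype → Function.Bijective j) := by
  obtain ⟨e, he, hee, hinv⟩ := exists_idempotent_endomorphism hφ
  let E := LinearMap.range e
  have hfix : ∀ x : E, e x = x := by
    rintro ⟨_, y, rfl⟩
    exact LinearMap.congr_fun hee y
  have hφe : ∀ x, φ (e x) = φ x := LinearMap.congr_fun he
  refine ⟨E, hph.comp _, fun m => ?_, fun G _ _ ψ hψ => ?_, ?_⟩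
  · obtain ⟨x, rfl⟩ := hsurj m
    exact ⟨e.rangeRestrict x, hφe x⟩
  · obtain ⟨h, rfl⟩ := hψ.exists_lift hsurj hφ
    exact ⟨e.rangeRestrict.comp h, LinearMap.ext fun g => hφe (h g)⟩
  have hleft : ∀ j : E →ₗ[R] E, (φ.comp E.subtype).comp j = φ.comp E.subtype →
      ∃ k : E →ₗ[R] E, (φ.comp E.subtype).comp k = φ.comp E.subtype ∧
        k.comp j = LinearMap.id := by
    intro j hj
    have hres : ∀ x : E, e.rangeRestrict x = x := fun x => Subtype.ext (hfix x)
    obtain ⟨k, hk, hek, hke, hkj⟩ := hinv (E.subtype.comp (j.comp e.rangeRestrict))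
      (LinearMap.ext fun x => (LinearMap.congr_fun hj _).trans (hφe x))
      (LinearMap.ext fun x => hfix _)
      (LinearMap.ext fun x => congrArg (fun y => (j y : F)) (hres (e.rangeRestrict x)))
    refine ⟨e.rangeRestrict.comp (k.comp E.subtype), LinearMap.ext fun x => ?_,
      LinearMap.ext fun x => Subtype.ext ?_⟩
    · exact (hφe _).trans (LinearMap.congr_fun hk x)
    · have h1 := LinearMap.congr_fun hek (j x)
      have h2 := LinearMap.congr_fun hkj x
      simp only [LinearMap.comp_apply, Submodule.subtype_apply, hres, hfix] at h1 h2
      simpa [h1] using h2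
  intro j hj
  obtain ⟨k, hk, hkj⟩ := hleft j hj
  obtain ⟨l, -, hlk⟩ := hleft k hk
  have hlj : l = j := by
    rw [← LinearMap.comp_id l, ← hkj, ← LinearMap.comp_assoc, hlk, LinearMap.id_comp]
  subst hlj
  exact Function.bijective_iff_has_inverse.2
    ⟨k, LinearMap.congr_fun hkj, LinearMap.congr_fun hlk⟩

/-! ### A phantom precover with compact fibres -/

section DoubleDual

/-- The Bohr-type double dual of a module: additive maps from its character group to the circle. -/
def DoubleDual (P : Type*) [AddCommGroup P] : Type _ :=
  CharacterModule P →+ UnitAddCircle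

namespace DoubleDual

variable {R : Type*} [Ring R] {P : Type*} [AddCommGroup P] [Module R P]

instance : AddCommGroup (DoubleDual P) :=
  inferInstanceAs (AddCommGroup (CharacterModule P →+ UnitAddCircle))

instance : FunLike (DoubleDual P) (CharacterModule P) UnitAddCircle :=
  inferInstanceAs (FunLike (CharacterModule P →+ UnitAddCircle) _ _)

instance : AddMonoidHomClass (DoubleDual P) (CharacterModule P) UnitAddCircle :=
  inferInstanceAs (AddMonoidHomClass (CharacterModule P →+ UnitAddCircle) _ _)

@[ext] lemma ext {ξ η : DoubleDual P} (h : ∀ χ, ξ χ = η χ) : ξ = η := DFunLike.ext _ _ h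

@[simp] lemma add_apply (ξ η : DoubleDual P) (χ : CharacterModule P) : (ξ + η) χ = ξ χ + η χ := rfl

@[simp] lemma zero_apply (χ : CharacterModule P) : (0 : DoubleDual P) χ = 0 := rfl

end DoubleDual

/-- Precomposition of characters with an additive map. -/
def CharacterModule.precomp {P Q : Type*} [AddCommGroup P] [AddCommGroup Q] (f : P →+ Q) :
    CharacterModule Q →+ CharacterModule P :=
  AddMonoidHom.compHom' f

@[simp] lemma CharacterModule.precomp_apply {P Q : Type*} [AddCommGroup P] [AddCommGroup Q]
    (f : P →+ Q) (χ : CharacterModule Q) (p : P) : CharacterModule.precomp f χ p = χ (f p) := rfl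

lemma CharacterModule.add_apply {P : Type*} [AddCommGroup P] (χ μ : CharacterModule P) (p : P) :
    (χ + μ) p = χ p + μ p := rfl

namespace DoubleDual

variable {R : Type*} [Ring R] {P : Type*} [AddCommGroup P] [Module R P]

instance : SMul R (DoubleDual P) :=
  ⟨fun r ξ => AddMonoidHom.comp ξ
    (CharacterModule.precomp (DistribSMul.toAddMonoidHom P r))⟩

lemma smul_apply (r : R) (ξ : DoubleDual P) (χ : CharacterModule P) :
    (r • ξ) χ = ξ (CharacterModule.precomp (DistribSMul.toAddMonoidHom P r) χ) := rfl

instance : Module R (DoubleDual P) where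
  one_smul ξ := by
    ext χ
    rw [smul_apply]
    congr 1
    ext p
    simp
  mul_smul r s ξ := by
    ext χ
    simp only [smul_apply]
    congr 1
    ext p
    simp [mul_smul]
  smul_zero r := rfl
  smul_add r ξ η := rfl
  add_smul r s ξ := by
    ext χ
    simp only [smul_apply, add_apply, ← map_add]
    congr 1
    ext p
    simp [add_smul, CharacterModule.add_apply]
  zero_smul ξ := by
    ext χ
    rw [smul_apply, zero_apply, ← map_zero ξ]
    congr 1
    ext p
    simp only [CharacterModule.precomp_apply, DistribSMul.toAddMonoidHom_apply, zero_smul,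
      map_zero]
    rfl

end DoubleDual

/-- The inclusion of the rational circle in the real circle. -/
noncomputable def ratCircleToCircle : AddCircle (1 : ℚ) →+ UnitAddCircle :=
  QuotientAddGroup.map _ _ (Rat.castHom ℝ).toAddMonoidHom (by
    rw [AddSubgroup.zmultiples_le]
    exact AddSubgroup.mem_zmultiples_iff.2 ⟨1, by simp⟩)

lemma ratCircleToCircle_injective : Function.Injective ratCircleToCircle := by
  refine (injective_iff_map_eq_zero _).2 fun x hx => ?_
  obtain ⟨q, rfl⟩ := QuotientAddGroup.mk_surjective x
  obtain ⟨n, hn⟩ := AddSubgroup.mem_zmultiples_iff.1 ((QuotientAddGroup.eq_zero_iff _).1 hx)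
  refine (QuotientAddGroup.eq_zero_iff _).2 (AddSubgroup.mem_zmultiples_iff.2 ⟨n, ?_⟩)
  simp only [zsmul_eq_mul, mul_one] at hn ⊢
  have h2 : ((n : ℚ) : ℝ) = (q : ℝ) := by
    rw [Rat.cast_intCast]
    exact hn
  exact_mod_cast h2

/-- Characters separate points from subgroups. -/
lemma exists_character_of_notMem {X : Type*} [AddCommGroup X] (S : AddSubgroup X) {x : X}
    (hx : x ∉ S) : ∃ χ : CharacterModule X, (∀ y ∈ S, χ y = 0) ∧ χ x ≠ 0 := by
  obtain ⟨c, hc⟩ := CharacterModule.exists_character_apply_ne_zero_of_ne_zero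
    (a := (QuotientAddGroup.mk' S x)) (fun h => hx ((QuotientAddGroup.eq_zero_iff x).1 h))
  refine ⟨CharacterModule.precomp (QuotientAddGroup.mk' S) c, fun y hy => ?_, hc⟩
  rw [CharacterModule.precomp_apply, QuotientAddGroup.mk'_apply,
    (QuotientAddGroup.eq_zero_iff y).2 hy, map_zero]

variable {R : Type u} [Ring R] {P M : Type u} [AddCommGroup P] [AddCommGroup M] [Module R P]
  [Module R M]

/-- The pullback of the canonical map from `M` to its double dual along the double dual of `π`. -/
def compactPullback (π : P →ₗ[R] M) : Submodule R (DoubleDual P × M) where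
  carrier := {x | ∀ μ : CharacterModule M,
    x.1 (CharacterModule.precomp π.toAddMonoidHom μ) = ratCircleToCircle (μ x.2)}
  add_mem' {x y} hx hy μ := by simp [hx μ, hy μ]
  zero_mem' μ := by simp
  smul_mem' r x hx μ := by
    have h := hx (CharacterModule.precomp (DistribSMul.toAddMonoidHom M r) μ)
    refine Eq.trans ?_ h
    rw [Prod.smul_fst, DoubleDual.smul_apply]
    congr 1
    ext p
    simp

/-- The projection from the pullback to `M`. -/
def compactPullback.proj (π : P →ₗ[R] M) : compactPullback π →ₗ[R] M :=
  (LinearMap.snd R _ _).comp (compactPullback π).subtype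

lemma compactPullback.proj_surjective {π : P →ₗ[R] M} (hπ : Function.Surjective π) :
    Function.Surjective (compactPullback.proj π) := by
  intro m
  obtain ⟨p, rfl⟩ := hπ m
  let ev : CharacterModule P →+ UnitAddCircle :=
    { toFun := fun χ => ratCircleToCircle (χ p)
      map_zero' := map_zero ratCircleToCircle
      map_add' := fun χ μ => by rw [CharacterModule.add_apply, map_add] }
  exact ⟨⟨((ev : DoubleDual P), π p), fun μ => rfl⟩, rfl⟩

/-- The values of a point of the pullback at all characters. -/
def compactPullback.toFun (π : P →ₗ[R] M) :
    compactPullback π →+ (CharacterModule P → UnitAddCircle) where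
  toFun x χ := x.1.1 χ
  map_zero' := rfl
  map_add' _ _ := rfl

lemma compactPullback.toFun_injective (π : P →ₗ[R] M) :
    Function.Injective (compactPullback.toFun π) := by
  rintro ⟨⟨ξ, m⟩, hx⟩ ⟨⟨η, n⟩, hy⟩ h
  obtain rfl : ξ = η := DoubleDual.ext (congrFun h)
  have hmn : m - n = 0 := CharacterModule.eq_zero_of_character_apply fun μ => by
    rw [map_sub, sub_eq_zero]
    exact ratCircleToCircle_injective ((hx μ).symm.trans (hy μ))
  obtain rfl := sub_eq_zero.1 hmn
  rfl

instance (π : P →ₗ[R] M) : TopologicalSpace (compactPullback π) :=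
  .induced (compactPullback.toFun π) inferInstance

lemma compactPullback.isInducing_toFun (π : P →ₗ[R] M) :
    Topology.IsInducing (compactPullback.toFun π) := ⟨rfl⟩

instance (π : P →ₗ[R] M) : T2Space (compactPullback π) :=
  (Topology.IsEmbedding.mk (compactPullback.isInducing_toFun π)
    (compactPullback.toFun_injective π)).t2Space

instance (π : P →ₗ[R] M) : ContinuousAdd (compactPullback π) :=
  (compactPullback.isInducing_toFun π).continuousAdd _

instance (π : P →ₗ[R] M) : ContinuousConstSMul R (compactPullback π) where
  continuous_const_smul r := by
    refine (compactPullback.isInducing_toFun π).continuous_iff.2 (continuous_pi fun χ => ?_)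
    exact (continuous_apply (CharacterModule.precomp (DistribSMul.toAddMonoidHom P r) χ)).comp
      (compactPullback.isInducing_toFun π).continuous

lemma compactPullback.isCompact_fibre (π : P →ₗ[R] M) (m : M) :
    IsCompact (compactPullback.proj π ⁻¹' {m}) := by
  rw [(compactPullback.isInducing_toFun π).isCompact_iff]
  have : compactPullback.toFun π '' (compactPullback.proj π ⁻¹' {m}) =
      Set.range (DFunLike.coe : (CharacterModule P →+ UnitAddCircle) → _) ∩
        ⋂ μ : CharacterModule M, {f | f (CharacterModule.precomp π.toAddMonoidHom μ) =
          ratCircleToCircle (μ m)} := by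
    ext f
    simp only [Set.mem_inter_iff, Set.mem_iInter, Set.mem_ofPred_eq]
    constructor
    · rintro ⟨x, rfl, rfl⟩
      exact ⟨⟨x.1.1, rfl⟩, x.2⟩
    · rintro ⟨⟨ξ, rfl⟩, h⟩
      exact ⟨⟨((ξ : DoubleDual P), m), h⟩, rfl, rfl⟩
  rw [this]
  exact ((AddMonoidHom.isClosed_range_coe _ _).inter (isClosed_iInter fun μ =>
    isClosed_eq (continuous_apply _) continuous_const)).isCompact

/-- A finite system of homogeneous linear equations satisfied in the pullback can be satisfied in
`P` by elements with the same images in `M`. -/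
lemma compactPullback.exists_solution (π : P →ₗ[R] M) {n m : ℕ} (a : Fin m → Fin n → R)
    (x : Fin n → compactPullback π) (hx : ∀ l, ∑ i, a l i • x i = 0) :
    ∃ p : Fin n → P, (∀ l, ∑ i, a l i • p i = 0) ∧
      ∀ i, π (p i) = compactPullback.proj π (x i) := by
  classical
  let Θ : (Fin n → P) →+ (Fin m → P) × (Fin n → M) :=
    { toFun := fun p => (fun l => ∑ i, a l i • p i, fun i => π (p i))
      map_zero' := by ext <;> simp
      map_add' := fun p q => by ext <;> simp [Finset.sum_add_distrib] }
  by_contra hcon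
  obtain ⟨χ, hχ, hne⟩ := exists_character_of_notMem Θ.range
    (x := (0, fun i => (x i).1.2)) (by
      rintro ⟨p, hp⟩
      exact hcon ⟨p, congrFun (congrArg Prod.fst hp), congrFun (congrArg Prod.snd hp)⟩)
  let χ₁ : Fin m → CharacterModule P := fun l => CharacterModule.precomp
    ((AddMonoidHom.inl _ _).comp (AddMonoidHom.single (fun _ : Fin m => P) l)) χ
  let χ₂ : Fin n → CharacterModule M := fun i => CharacterModule.precomp
    ((AddMonoidHom.inr _ _).comp (AddMonoidHom.single (fun _ : Fin n => M) i)) χ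
  have hsplit : ∀ u v, χ (u, v) = ∑ l, χ₁ l (u l) + ∑ i, χ₂ i (v i) := by
    intro u v
    have hu : (u, v) = ∑ l, ((Pi.single l (u l), 0) : (Fin m → P) × (Fin n → M)) +
        ∑ i, ((0, Pi.single i (v i)) : (Fin m → P) × (Fin n → M)) := by
      ext <;> simp [Prod.fst_sum, Prod.snd_sum, Finset.sum_apply, Pi.single_apply]
    rw [hu, map_add, map_sum, map_sum]
    rfl
  let act : R → CharacterModule P →+ CharacterModule P := fun r =>
    CharacterModule.precomp (DistribSMul.toAddMonoidHom P r)
  have hrel : ∀ i, ∑ l, act (a l i) (χ₁ l) +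
      CharacterModule.precomp π.toAddMonoidHom (χ₂ i) = 0 := by
    intro i
    ext p
    have h := hχ _ ⟨Pi.single i p, rfl⟩
    change χ (_, _) = 0 at h
    have h1 : ∀ l, ∑ j, a l j • (Pi.single i p : Fin n → P) j = a l i • p := fun l => by
      rw [Finset.sum_eq_single i (fun j _ hj => by simp [hj]) (by simp), Pi.single_eq_same]
    have h2 : ∑ j, χ₂ j (π ((Pi.single i p : Fin n → P) j)) = χ₂ i (π p) := by
      rw [Finset.sum_eq_single i (fun j _ hj => by simp [hj]) (by simp), Pi.single_eq_same]
    rw [hsplit, h2] at h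
    simp only [h1] at h
    have h3 : (∑ l, act (a l i) (χ₁ l)) p = ∑ l, χ₁ l (a l i • p) :=
      map_sum (AddMonoidHom.eval p) (fun l => act (a l i) (χ₁ l)) Finset.univ
    rw [CharacterModule.add_apply, h3]
    exact h
  refine hne (ratCircleToCircle_injective ?_)
  rw [hsplit, map_zero, map_add, map_sum, map_sum]
  have h1 : ∀ i, ratCircleToCircle (χ₂ i ((x i).1.2)) = - ∑ l, (a l i • x i).1.1 (χ₁ l) := by
    intro i
    rw [← (x i).2 (χ₂ i), eq_neg_iff_add_eq_zero, add_comm]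
    have h2 := congrArg (x i).1.1 (hrel i)
    rw [map_add, map_sum, map_zero] at h2
    exact h2
  simp only [h1, Pi.zero_apply, map_zero, Finset.sum_const_zero, zero_add,
    Finset.sum_neg_distrib, neg_eq_zero]
  rw [Finset.sum_comm]
  refine Finset.sum_eq_zero fun l _ => ?_
  have h3 := congrFun (congrArg (compactPullback.toFun π) (hx l)) (χ₁ l)
  rw [map_sum, Finset.sum_apply, map_zero] at h3
  exact h3

lemma compactPullback.isPhantom_proj [Module.Projective R P] (π : P →ₗ[R] M) :
    IsPhantom (compactPullback.proj π) := by
  intro L _ _ _ g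
  obtain ⟨n, m, f, r, hf, hfr⟩ := Module.FinitePresentation.exists_fin' R L
  obtain ⟨p, hp, hpπ⟩ := compactPullback.exists_solution π (fun l => r (Pi.single l 1))
    (fun i => g (f (Pi.single i 1))) (fun l => by
      have h := hfr.apply_apply_eq_zero (Pi.single l 1)
      rw [pi_eq_sum_univ' (r (Pi.single l 1))] at h
      simpa [map_sum] using congrArg g h)
  obtain ⟨h, hh⟩ := LinearMap.exists_comp_eq_of_ker_le f hf (Fintype.linearCombination R p) (by
    rw [LinearMap.exact_iff.1 hfr]
    rintro _ ⟨y, rfl⟩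
    have : (Fintype.linearCombination R p).comp r = 0 := by
      ext l
      simpa [Fintype.linearCombination_apply] using hp l
    exact LinearMap.congr_fun this y)
  refine ⟨P, _, _, inferInstance, h, π, ?_⟩
  rw [← LinearMap.cancel_right hf, LinearMap.comp_assoc, hh]
  ext i
  simpa [Fintype.linearCombination_apply] using hpπ i

end DoubleDual

/-- **Every left `R`-module has a surjective phantom cover**: a surjective phantom morphism
`φ : F → M` such that every phantom morphism `ψ : G → M` factors through `φ`, and every
`j : F → F` with `φ ∘ j = φ` is an automorphism. -/
theorem exists_surjective_phantom_cover {R : Type u} [Ring R]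
    (M : Type u) [AddCommGroup M] [Module R M] :
    ∃ (F : Type u) (_ : AddCommGroup F) (_ : Module R F) (φ : F →ₗ[R] M),
      IsPhantom φ ∧ Function.Surjective φ ∧
      (∀ (G : Type u) [AddCommGroup G] [Module R G] (ψ : G →ₗ[R] M),
        IsPhantom ψ → ∃ h : G →ₗ[R] F, φ.comp h = ψ) ∧
      (∀ j : F →ₗ[R] F, φ.comp j = φ → Function.Bijective j) := by
  let π : (M →₀ R) →ₗ[R] M := Finsupp.linearCombination R id
  have hπ : Function.Surjective π := Finsupp.linearCombination_id_surjective R M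
  obtain ⟨E, hE⟩ := (compactPullback.isPhantom_proj π).exists_cover_of_isCompact_fibres
    (compactPullback.proj_surjective hπ) (compactPullback.isCompact_fibre π)
  exact ⟨E, _, _, _, hE⟩
end

section
/- Let R be a ring and let φ : M → N be a surjective phantom cover of the left R-module N. Then K = Ker(φ) is pure injective: for every pure monomorphism v : K → X of left R-modules there exists a homomorphism r : X → K with r ∘ v = id_K. -/
universe u

/-- A submodule `P ≤ M` is *pure* if every finite system of `R`-linear equations with
constants in `P` which is solvable in `M` is already solvable in `P` (this is the standard
equational characterization, over an arbitrary ring, of the requirement that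
`L ⊗_R P → L ⊗_R M` be injective for every right `R`-module `L`). -/
def IsPureSubmodule {R : Type u} [Ring R] {M : Type u} [AddCommGroup M] [Module R M]
    (P : Submodule R M) : Prop :=
  ∀ (m n : ℕ) (A : Matrix (Fin m) (Fin n) R) (b : Fin m → P),
    (∃ y : Fin n → M, ∀ i, ∑ j, A i j • y j = (b i : M)) →
    ∃ z : Fin n → P, ∀ i, ∑ j, A i j • z j = b i

/-- A homomorphism from a finitely presented module to a quotient by a pure submodule lifts. -/
theorem IsPureSubmodule.exists_lift {R : Type u} [Ring R] {Q : Type u} [AddCommGroup Q]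
    [Module R Q] {P : Submodule R Q} (hP : IsPureSubmodule P) {L : Type u} [AddCommGroup L]
    [Module R L] [Module.FinitePresentation R L] (g : L →ₗ[R] Q ⧸ P) :
    ∃ f : L →ₗ[R] Q, P.mkQ.comp f = g := by
  obtain ⟨n, K, e, hK⟩ := Module.FinitePresentation.exists_fin R L
  obtain ⟨m, A, hA⟩ := Submodule.fg_iff_exists_fin_generating_family.mp hK
  let G : (Fin n → R) →ₗ[R] Q ⧸ P := (g.comp e.symm.toLinearMap).comp K.mkQ
  choose q hq using fun j => P.mkQ_surjective (G (Pi.single j 1))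
  have hG (x : Fin n → Q) (hx : ∀ j, P.mkQ (x j) = G (Pi.single j 1)) :
      P.mkQ.comp (Fintype.linearCombination R x) = G := by
    refine LinearMap.pi_ext' fun j => LinearMap.ext_ring ?_
    simp [Fintype.linearCombination_apply_single, ← hx]
  have hmem (i : Fin m) : ∑ j, A i j • q j ∈ P := by
    have h := LinearMap.congr_fun (hG q hq) (A i)
    have h0 : G (A i) = 0 := by
      have : K.mkQ (A i) = 0 := by
        rw [Submodule.mkQ_apply, Submodule.Quotient.mk_eq_zero, ← hA]
        exact Submodule.subset_span ⟨i, rfl⟩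
      simp only [G, LinearMap.comp_apply, this, map_zero]
    rw [h0, LinearMap.comp_apply, Submodule.mkQ_apply, Submodule.Quotient.mk_eq_zero] at h
    exact h
  obtain ⟨z, hz⟩ := hP m n A (fun i => ⟨_, hmem i⟩) ⟨q, fun i => rfl⟩
  let F := Fintype.linearCombination R (fun j => q j - (z j : Q))
  have hF : P.mkQ.comp F = G := hG _ fun j => by simp [← hq]
  have hle : K ≤ LinearMap.ker F := by
    rw [← hA, Submodule.span_le]
    rintro _ ⟨i, rfl⟩
    have h := congrArg (Subtype.val : P → Q) (hz i)
    simp only [AddSubmonoidClass.coe_finsetSum, SetLike.val_smul] at h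
    simp [F, Fintype.linearCombination_apply, smul_sub, h]
  refine ⟨(K.liftQ F hle).comp e.toLinearMap, LinearMap.ext fun l => ?_⟩
  obtain ⟨x, hx⟩ := K.mkQ_surjective (e l)
  have h := LinearMap.congr_fun hF x
  simp only [G, LinearMap.comp_apply, hx] at h
  simp only [LinearMap.comp_apply, LinearEquiv.coe_coe, ← hx]
  simpa using h

/-- If `v` is a pure monomorphism, then so is `(u, v)` for every `u`. -/
theorem IsPureSubmodule.range_prod {R : Type u} [Ring R] {K M X : Type u} [AddCommGroup K]
    [AddCommGroup M] [AddCommGroup X] [Module R K] [Module R M] [Module R X] (u : K →ₗ[R] M)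
    {v : K →ₗ[R] X} (hv : Function.Injective v) (hpure : IsPureSubmodule (LinearMap.range v)) :
    IsPureSubmodule (LinearMap.range (u.prod v)) := by
  rintro m n A b ⟨y, hy⟩
  choose k hk using fun i => (b i).2
  obtain ⟨z, hz⟩ := hpure m n A (fun i => ⟨v (k i), k i, rfl⟩) ⟨fun j => (y j).2, fun i => by
    have h := congrArg Prod.snd ((hy i).trans (hk i).symm)
    simpa [Prod.snd_sum] using h⟩
  choose w hw using fun j => (z j).2
  refine ⟨fun j => ⟨u.prod v (w j), w j, rfl⟩, fun i => Subtype.ext ?_⟩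
  have h : ∑ j, A i j • w j = k i := hv <| by
    have h := congrArg (Subtype.val : LinearMap.range v → X) (hz i)
    simp only [AddSubmonoidClass.coe_finsetSum, SetLike.val_smul, ← hw] at h
    simpa using h
  simp only [AddSubmonoidClass.coe_finsetSum, SetLike.val_smul, ← map_smul, ← map_sum, h, hk]

/-- The kernel of a (surjective) phantom cover `φ : M → N` is pure injective: every pure
monomorphism `v : Ker φ → X` admits a retraction. -/
theorem pureInjective_ker_of_phantom_cover {R : Type u} [Ring R]
    {M N : Type u} [AddCommGroup M] [AddCommGroup N] [Module R M] [Module R N]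
    (φ : M →ₗ[R] N) (hφsurj : Function.Surjective φ) (hφ : IsPhantom φ)
    (hprecover : ∀ (G : Type u) [AddCommGroup G] [Module R G] (ψ : G →ₗ[R] N),
      IsPhantom ψ → ∃ h : G →ₗ[R] M, φ.comp h = ψ)
    (hcover : ∀ j : M →ₗ[R] M, φ.comp j = φ → Function.Bijective j) :
    ∀ (X : Type u) [AddCommGroup X] [Module R X] (v : (LinearMap.ker φ) →ₗ[R] X),
      Function.Injective v → IsPureSubmodule (LinearMap.range v) →
      ∃ r : X →ₗ[R] (LinearMap.ker φ), r.comp v = LinearMap.id := by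
  intro X _ _ v hv hpure
  let P := LinearMap.range ((-(LinearMap.ker φ).subtype).prod v)
  have hP : IsPureSubmodule P := IsPureSubmodule.range_prod _ hv hpure
  have hle : P ≤ LinearMap.ker (φ.comp (LinearMap.fst R M X)) := by
    rintro _ ⟨k, rfl⟩
    simp
  let ψ : ((M × X) ⧸ P) →ₗ[R] N := P.liftQ _ hle
  have hψ : IsPhantom ψ := by
    intro L _ _ _ g
    obtain ⟨f, rfl⟩ := hP.exists_lift g
    obtain ⟨S, i₁, i₂, i₃, α, β, h⟩ := hφ L ((LinearMap.fst R M X).comp f)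
    refine ⟨S, i₁, i₂, i₃, α, β, h.trans (LinearMap.ext fun l => ?_)⟩
    simp [ψ]
  obtain ⟨h, hh⟩ := hprecover _ ψ hψ
  have hφh (p : M × X) : φ (h (P.mkQ p)) = φ p.1 := by
    simpa [ψ] using LinearMap.congr_fun hh (P.mkQ p)
  let j : M →ₗ[R] M := (h.comp P.mkQ).comp (LinearMap.inl R M X)
  have hj : φ.comp j = φ := LinearMap.ext fun x => hφh (x, 0)
  let e : M ≃ₗ[R] M := LinearEquiv.ofBijective j (hcover j hj)
  have he (x : M) : φ (e.symm x) = φ x := by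
    have := LinearMap.congr_fun hj (e.symm x)
    rw [← this]
    exact congrArg φ (e.apply_symm_apply x)
  let r : X →ₗ[R] M := e.symm.toLinearMap.comp ((h.comp P.mkQ).comp (LinearMap.inr R M X))
  have hr (x : X) : r x ∈ LinearMap.ker φ := by
    rw [LinearMap.mem_ker]
    exact (he _).trans ((hφh (0, x)).trans (map_zero φ))
  refine ⟨r.codRestrict _ hr, LinearMap.ext fun k => Subtype.ext ?_⟩
  have hk : P.mkQ (0, v k) = P.mkQ ((k : M), 0) := by
    rw [← sub_eq_zero, ← map_sub, Submodule.mkQ_apply, Submodule.Quotient.mk_eq_zero]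
    exact ⟨k, by simp⟩
  change e.symm (h (P.mkQ (0, v k))) = k
  rw [hk]
  exact e.symm_apply_apply k
end
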